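/- arXiv:0808.2822 — 2 statements merged into one kernel-verified Lean document; each statement's English description precedes it below -/
import Mathlib

section
/- For every n ≥ 1, the generating polynomial of the type B major index over all Dyck paths of type B_n equals the Gaussian binomial coefficient [2n choose n] evaluated at q²; that is, Σ_w q^{maj(w)} = Π_{i=1}^{n} (1 − q^{2(n+i)})/(1 − q^{2i}), the sum being over all Dyck paths w of type B_n. (This Gaussian binomial is the q-Catalan number of the reflection group B_n, namely Π_{i=1}^{n} [d_i + h]_q/[d_i]_q with degrees d_i = 2i and Coxeter number h = 2n.) -/
open scoped Classical

namespace Stmt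

/-- Number of north steps (`true`) among the first `k` steps of the path `w`. -/
def countN {m : ℕ} (w : Fin m → Bool) (k : ℕ) : ℕ :=
  (Finset.univ.filter (fun t : Fin m => (t : ℕ) < k ∧ w t = true)).card

/-- Number of east steps (`false`) among the first `k` steps of the path `w`. -/
def countE {m : ℕ} (w : Fin m → Bool) (k : ℕ) : ℕ :=
  (Finset.univ.filter (fun t : Fin m => (t : ℕ) < k ∧ w t = false)).card

/-- A Dyck path of length `n`: `n` north and `n` east steps, every prefix has
at least as many north as east steps. -/
def IsDyckA (n : ℕ) (w : Fin (2 * n) → Bool) : Prop :=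
  countN w (2 * n) = n ∧ ∀ k : ℕ, countE w k ≤ countN w k

/-- A Dyck path of type `B_n`: `2n` steps, every prefix has at least as many
north as east steps. -/
def IsDyckB (n : ℕ) (w : Fin (2 * n) → Bool) : Prop :=
  ∀ k : ℕ, countE w k ≤ countN w k

/-- The unit cell `[i-1,i] × [j-1,j]` lies below the lattice path `w`:
at some time the path has `x`-coordinate `< i` and `y`-coordinate `≥ j`. -/
def CellBelow {m : ℕ} (w : Fin m → Bool) (i j : ℕ) : Prop :=
  ∃ k : ℕ, countE w k < i ∧ j ≤ countN w k

/-- Area of a (type `A`) Dyck path: number of cells `b_{i,j}` with `i < j`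
lying below the path. -/
noncomputable def areaA {m : ℕ} (w : Fin m → Bool) : ℕ :=
  {p : ℕ × ℕ | 1 ≤ p.1 ∧ p.1 < p.2 ∧ CellBelow w p.1 p.2}.ncard

/-- Area of a type `B_n` Dyck path: number of cells `b_{i,j}` with
`1 ≤ i < j ≤ 2n+1-i` lying below the path. -/
noncomputable def areaB (n : ℕ) (w : Fin (2 * n) → Bool) : ℕ :=
  {p : ℕ × ℕ | 1 ≤ p.1 ∧ p.1 < p.2 ∧ p.2 ≤ 2 * n + 1 - p.1 ∧
    CellBelow w p.1 p.2}.ncard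

/-- Descent set of a path, 1-indexed: positions `i` with `w_i = E`, `w_{i+1} = N`. -/
def pathDes {m : ℕ} (w : Fin m → Bool) : Finset ℕ :=
  (Finset.Ioo 0 m).filter (fun i =>
    ∃ h : i < m, w ⟨i - 1, Nat.lt_of_le_of_lt (Nat.sub_le i 1) h⟩ = false ∧ w ⟨i, h⟩ = true)

def desPath {m : ℕ} (w : Fin m → Bool) : ℕ := (pathDes w).card

/-- Major index of a Dyck path of length `n`: `maj(w) = ∑_{i ∈ Des(w)} (2n - i)`. -/
def majA (n : ℕ) (w : Fin (2 * n) → Bool) : ℕ :=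
  ∑ i ∈ pathDes w, (2 * n - i)

/-- Number of east steps of a path. -/
def negPath {m : ℕ} (w : Fin m → Bool) : ℕ :=
  (Finset.univ.filter (fun t : Fin m => w t = false)).card

/-- Type `B` major index: `maj(w) = 2 ⬝ (neg(w) + ∑_{i ∈ Des(w)} (2n - i))`. -/
def majB (n : ℕ) (w : Fin (2 * n) → Bool) : ℕ :=
  2 * (negPath w + ∑ i ∈ pathDes w, (2 * n - i))

/-- Gaussian binomial coefficient `[m choose j]` at `q`, with integer lower index
(zero unless `0 ≤ j ≤ m`). -/
noncomputable def gaussBinom {K : Type*} [Field K] (q : K) : ℕ → ℤ → K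
  | 0, j => if j = 0 then 1 else 0
  | m + 1, j => gaussBinom q m (j - 1) + q ^ j * gaussBinom q m j

/-- The path `w`, started at height `h`, never goes below height `0`. -/
def IsBallot {m : ℕ} (h : ℕ) (w : Fin m → Bool) : Prop :=
  ∀ k : ℕ, countE w k ≤ countN w k + h

/-- The sum of `m - i` over the descents `i` of a path of length `m`. -/
def comaj {m : ℕ} (w : Fin m → Bool) : ℕ :=
  ∑ i ∈ pathDes w, (m - i)

/-- Generating function of `comaj` over the paths of length `m` with `b` east steps that stay
nonnegative when started at height `h`. -/
noncomputable def ballotSum {K : Type*} [Field K] (q : K) (m h : ℕ) (b : ℤ) : K :=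
  ∑ w : Fin m → Bool, if IsBallot h w ∧ (negPath w : ℤ) = b then q ^ comaj w else 0

/-- Generating function of `comaj` over the paths consisting of an east step followed by `m`
steps, `b` of them east, that stay nonnegative when started at height `h`. -/
noncomputable def ballotSumEast {K : Type*} [Field K] (q : K) (m h : ℕ) (b : ℤ) : K :=
  ∑ w : Fin m → Bool, if IsBallot h (Fin.cons false w : Fin (m + 1) → Bool) ∧
    (negPath w : ℤ) = b then q ^ comaj (Fin.cons false w : Fin (m + 1) → Bool) else 0

section GaussBinom

variable {K : Type*} [Field K] {q : K}

lemma gaussBinom_succ (q : K) (m : ℕ) (j : ℤ) :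
    gaussBinom q (m + 1) j = gaussBinom q m (j - 1) + q ^ j * gaussBinom q m j :=
  rfl

lemma gaussBinom_succ' (hq : q ≠ 0) (m : ℕ) (j : ℤ) :
    gaussBinom q (m + 1) j =
      q ^ ((m : ℤ) + 1 - j) * gaussBinom q m (j - 1) + gaussBinom q m j := by
  induction m generalizing j with
  | zero =>
    simp only [gaussBinom]
    by_cases h0 : j = 0
    · subst h0; simp
    · by_cases h1 : j = 1
      · subst h1; simp
      · have : j - 1 ≠ 0 := by omega
        simp [h0, this]
  | succ m ih =>
    have h1 := ih (j - 1)
    have h2 := gaussBinom_succ q m (j - 1)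
    have h3 := ih j
    have h4 := gaussBinom_succ q m j
    rw [gaussBinom_succ q (m + 1) j]
    have e1 : ((m : ℤ) + 1 - (j - 1)) = (m + 1 : ℕ) + 1 - j := by push_cast; ring
    have e2 : q ^ j * q ^ ((m : ℤ) + 1 - j) = q ^ (((m + 1 : ℕ) : ℤ) + 1 - j) * q ^ (j - 1) := by
      rw [← zpow_add₀ hq, ← zpow_add₀ hq]; congr 1; push_cast; ring
    rw [e1] at h1
    linear_combination h1 + q ^ j * h3 - q ^ (((m + 1 : ℕ) : ℤ) + 1 - j) * h2 - h4 +
      gaussBinom q m (j - 1) * e2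

lemma gaussBinom_of_neg (m : ℕ) {j : ℤ} (hj : j < 0) : gaussBinom q m j = 0 := by
  induction m generalizing j with
  | zero => simp [gaussBinom, hj.ne]
  | succ m ih => simp [gaussBinom, ih hj, ih (show j - 1 < 0 by omega)]

lemma gaussBinom_zero_right (m : ℕ) : gaussBinom q m 0 = 1 := by
  induction m with
  | zero => simp [gaussBinom]
  | succ m ih => simp [gaussBinom, ih, gaussBinom_of_neg (q := q) m (show (-1 : ℤ) < 0 by omega)]

lemma one_sub_mul_gaussBinom (hq : q ≠ 0) (m : ℕ) (j : ℤ) :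
    (1 - q ^ j) * gaussBinom q m j =
      (1 - q ^ ((m : ℤ) + 1 - j)) * gaussBinom q m (j - 1) := by
  have h := gaussBinom_succ' hq m j
  rw [gaussBinom] at h
  linear_combination -h

lemma gaussBinom_eq_prod (hq : q ≠ 0) (hq1 : ∀ i : ℕ, 1 ≤ i → q ^ i ≠ 1) (m k : ℕ)
    (hk : k ≤ m) :
    gaussBinom q m k = ∏ i ∈ Finset.range k, (1 - q ^ (m - i)) / (1 - q ^ (i + 1)) := by
  induction k with
  | zero => simpa using gaussBinom_zero_right m
  | succ k ih =>
    rw [Finset.prod_range_succ, ← ih (by omega)]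
    have h := one_sub_mul_gaussBinom hq m ((k + 1 : ℕ) : ℤ)
    have e1 : ((m : ℤ) + 1 - (k + 1 : ℕ)) = (m - k : ℕ) := by omega
    have e2 : (((k + 1 : ℕ) : ℤ) - 1) = (k : ℕ) := by omega
    rw [e1, e2, zpow_natCast, zpow_natCast] at h
    have h1 : 1 - q ^ (k + 1) ≠ 0 := sub_ne_zero.mpr (hq1 (k + 1) (by omega)).symm
    field_simp
    linear_combination h

lemma gaussBinom_central (hq : q ≠ 0) (hq1 : ∀ i : ℕ, 1 ≤ i → q ^ i ≠ 1) (n : ℕ) :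
    gaussBinom q (2 * n) n = ∏ i ∈ Finset.Icc 1 n, (1 - q ^ (n + i)) / (1 - q ^ i) := by
  rw [gaussBinom_eq_prod hq hq1 _ _ (by omega), Finset.prod_div_distrib,
    Finset.prod_div_distrib]
  congr 1
  · refine Finset.prod_bij' (fun i _ => n - i) (fun i _ => n - i) ?_ ?_ ?_ ?_ ?_ <;> intro i hi
    iterate 4 (simp only [Finset.mem_range, Finset.mem_Icc] at hi ⊢; omega)
    rw [Finset.mem_range] at hi
    congr 2
    omega
  · refine Finset.prod_bij' (fun i _ => i + 1) (fun i _ => i - 1) ?_ ?_ ?_ ?_ ?_ <;> intro i hi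
    iterate 2 (simp only [Finset.mem_range, Finset.mem_Icc] at hi ⊢; omega)
    · omega
    · have := (Finset.mem_Icc.mp hi).1
      omega
    · rfl

end GaussBinom

section Cons

variable {m : ℕ}

lemma countN_cons_succ (a : Bool) (w : Fin m → Bool) (k : ℕ) :
    countN (Fin.cons a w : Fin (m + 1) → Bool) (k + 1) =
      (if a = true then 1 else 0) + countN w k := by
  simp [countN, Finset.card_filter, Fin.sum_univ_succ, -Finset.sum_boole]

lemma countE_cons_succ (a : Bool) (w : Fin m → Bool) (k : ℕ) :
    countE (Fin.cons a w : Fin (m + 1) → Bool) (k + 1) =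
      (if a = false then 1 else 0) + countE w k := by
  simp [countE, Finset.card_filter, Fin.sum_univ_succ, -Finset.sum_boole]

lemma countE_zero (w : Fin m → Bool) : countE w 0 = 0 := by
  simp [countE]

lemma negPath_cons (a : Bool) (w : Fin m → Bool) :
    negPath (Fin.cons a w : Fin (m + 1) → Bool) = (if a = false then 1 else 0) + negPath w := by
  simp [negPath, Finset.card_filter, Fin.sum_univ_succ, -Finset.sum_boole]

lemma isBallot_cons (h : ℕ) (a : Bool) (w : Fin m → Bool) :
    IsBallot h (Fin.cons a w : Fin (m + 1) → Bool) ↔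
      ∀ k, (if a = false then 1 else 0) + countE w k ≤
        (if a = true then 1 else 0) + countN w k + h := by
  constructor
  · intro H k
    simpa [countN_cons_succ, countE_cons_succ] using H (k + 1)
  · rintro H (_ | k)
    · simp [countE_zero]
    · simpa [countN_cons_succ, countE_cons_succ] using H k

lemma isBallot_cons_true (h : ℕ) (w : Fin m → Bool) :
    IsBallot h (Fin.cons true w : Fin (m + 1) → Bool) ↔ IsBallot (h + 1) w := by
  rw [isBallot_cons]
  refine forall_congr' fun k => ?_
  simp only [Bool.true_eq_false, if_true, if_false]
  omega

lemma isBallot_cons_false_succ (h : ℕ) (w : Fin m → Bool) :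
    IsBallot (h + 1) (Fin.cons false w : Fin (m + 1) → Bool) ↔ IsBallot h w := by
  rw [isBallot_cons]
  refine forall_congr' fun k => ?_
  simp only [Bool.false_eq_true, if_true, if_false]
  omega

lemma not_isBallot_zero_cons_false (w : Fin m → Bool) :
    ¬ IsBallot 0 (Fin.cons false w : Fin (m + 1) → Bool) := by
  rw [isBallot_cons]
  intro H
  simpa [countN] using H 0

lemma comaj_eq_sum_range (w : Fin m → Bool) :
    comaj w = ∑ i ∈ Finset.range m,
      if ∃ h : i < m, 0 < i ∧ w ⟨i - 1, Nat.lt_of_le_of_lt (Nat.sub_le i 1) h⟩ = false ∧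
        w ⟨i, h⟩ = true then m - i else 0 := by
  rw [comaj, ← Finset.sum_filter]
  refine Finset.sum_congr ?_ fun _ _ => rfl
  ext i
  simp only [pathDes, Finset.mem_filter, Finset.mem_Ioo, Finset.mem_range]
  constructor
  · rintro ⟨⟨h0, h1⟩, h, hE, hN⟩
    exact ⟨h, h, h0, hE, hN⟩
  · rintro ⟨h, _, h0, hE, hN⟩
    exact ⟨⟨h0, h⟩, h, hE, hN⟩

lemma comaj_cons_cons (a c : Bool) (w : Fin m → Bool) :
    comaj (Fin.cons a (Fin.cons c w : Fin (m + 1) → Bool) : Fin (m + 2) → Bool) =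
      comaj (Fin.cons c w : Fin (m + 1) → Bool) +
        if a = false ∧ c = true then m + 1 else 0 := by
  rw [comaj_eq_sum_range, comaj_eq_sum_range, Finset.sum_range_succ', Finset.sum_range_succ',
    Finset.sum_range_succ']
  simp only [lt_irrefl, false_and, exists_false, if_false, add_zero]
  congr 1
  · refine Finset.sum_congr rfl fun i hi => ?_
    have hi := Finset.mem_range.mp hi
    congr 1
    · have e : (⟨i + 1, by omega⟩ : Fin (m + 2)) = Fin.succ ⟨i, by omega⟩ := rfl
      have e' : (⟨i + 1 + 1, by omega⟩ : Fin (m + 2)) = Fin.succ ⟨i + 1, by omega⟩ := rfl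
      simp [hi, e, e', -Fin.succ_mk]
    · omega
  · have e' : (⟨0 + 1, by omega⟩ : Fin (m + 2)) = Fin.succ 0 := rfl
    simp [e', -Fin.succ_mk]

lemma comaj_of_le_one (hm : m ≤ 1) (w : Fin m → Bool) : comaj w = 0 := by
  have : pathDes w = ∅ := by
    rw [pathDes, Finset.filter_eq_empty_iff]
    intro i hi
    rw [Finset.mem_Ioo] at hi
    omega
  simp [comaj, this]

lemma comaj_cons_true (w : Fin m → Bool) :
    comaj (Fin.cons true w : Fin (m + 1) → Bool) = comaj w := by
  cases m with
  | zero => rw [comaj_of_le_one (by omega), comaj_of_le_one (by omega)]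
  | succ m =>
    obtain ⟨c, u, rfl⟩ : ∃ c u, w = Fin.cons c u := ⟨w 0, Fin.tail w, (Fin.cons_self_tail w).symm⟩
    simp [comaj_cons_cons]

lemma sum_cons {M : Type*} [AddCommMonoid M] (f : (Fin (m + 1) → Bool) → M) :
    ∑ w, f w = ∑ w : Fin m → Bool, f (Fin.cons true w) +
      ∑ w : Fin m → Bool, f (Fin.cons false w) := by
  rw [← (Fin.consEquiv (fun _ : Fin (m + 1) => Bool)).sum_comp, Fintype.sum_prod_type,
    Fintype.sum_bool]
  rfl

end Cons

section BallotSum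

variable {K : Type*} [Field K] {q : K}

lemma ballotSum_succ (m h : ℕ) (b : ℤ) :
    ballotSum q (m + 1) h b = ballotSum q m (h + 1) b + ballotSumEast q m h (b - 1) := by
  rw [ballotSum, sum_cons]
  have e : ∀ x : ℕ, (1 + (x : ℤ) = b) ↔ ((x : ℤ) = b - 1) := fun x => by omega
  congr 1
  · simp [ballotSum, isBallot_cons_true, negPath_cons, comaj_cons_true]
  · simp [ballotSumEast, negPath_cons, e]

lemma ballotSumEast_zero_height (m : ℕ) (b : ℤ) : ballotSumEast q m 0 b = 0 := by
  simp [ballotSumEast, not_isBallot_zero_cons_false]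

lemma ballotSumEast_succ_succ (m h : ℕ) (b : ℤ) :
    ballotSumEast q (m + 1) (h + 1) b =
      q ^ (m + 1) * ballotSum q m (h + 1) b + ballotSumEast q m h (b - 1) := by
  rw [ballotSumEast, sum_cons]
  have e : ∀ x : ℕ, (1 + (x : ℤ) = b) ↔ ((x : ℤ) = b - 1) := fun x => by omega
  congr 1
  · simp [ballotSum, isBallot_cons_true, isBallot_cons_false_succ, negPath_cons, comaj_cons_cons,
      comaj_cons_true, Finset.mul_sum, pow_add, mul_comm]
  · simp [ballotSumEast, isBallot_cons_false_succ, negPath_cons, comaj_cons_cons, e]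

lemma ballotSum_zero_length (h : ℕ) (b : ℤ) :
    ballotSum q 0 h b = if b = 0 then 1 else 0 := by
  simp [ballotSum, IsBallot, countE, negPath, comaj_of_le_one, eq_comm (a := (0 : ℤ))]

lemma ballotSumEast_zero_length (h : ℕ) (b : ℤ) :
    ballotSumEast q 0 (h + 1) b = if b = 0 then 1 else 0 := by
  simp only [ballotSumEast, isBallot_cons_false_succ]
  simp [IsBallot, countE, negPath, comaj_of_le_one,
    eq_comm (a := (0 : ℤ))]

/-- Reflection formulas for the constrained generating functions. -/
lemma ballotSum_formulas (hq : q ≠ 0) (m : ℕ) :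
    (∀ (h : ℕ) (b : ℤ), 2 * b ≤ m + h → ballotSum q m h b =
      gaussBinom q m b - q ^ ((m : ℤ) + h + 1 - 2 * b) * gaussBinom q m (b - h - 1)) ∧
    (∀ (h : ℕ) (b : ℤ), 2 * b + 1 ≤ m + h → ballotSumEast q m h b =
      q ^ ((m : ℤ) - b) * (gaussBinom q m b - gaussBinom q m (b - h))) := by
  induction m with
  | zero =>
    constructor
    · intro h b hb
      have : b - h - 1 ≠ 0 := by omega
      simp [ballotSum_zero_length, gaussBinom, this]
    · rintro (_ | h) b hb
      · simp [ballotSumEast_zero_height]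
      · have : b - ((h + 1 : ℕ) : ℤ) ≠ 0 := by omega
        rw [ballotSumEast_zero_length, gaussBinom, gaussBinom, if_neg this]
        by_cases h0 : b = 0
        · simp [h0]
        · simp [h0]
  | succ m ih =>
    obtain ⟨ih, ihE⟩ := ih
    constructor
    · intro h b hb
      rw [ballotSum_succ, ih (h + 1) b (by push_cast at hb ⊢; omega),
        ihE h (b - 1) (by push_cast at hb ⊢; omega), gaussBinom_succ' hq m b,
        gaussBinom_succ q m (b - h - 1)]
      have e1 : (m : ℤ) + (h + 1 : ℕ) + 1 - 2 * b = (m + 1 : ℕ) + h + 1 - 2 * b := by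
        push_cast; ring
      have e2 : b - ((h + 1 : ℕ) : ℤ) - 1 = b - h - 1 - 1 := by push_cast; ring
      have e3 : b - 1 - (h : ℤ) = b - h - 1 := by ring
      have e4 : (m : ℤ) - (b - 1) = m + 1 - b := by ring
      have e5 : q ^ (((m + 1 : ℕ) : ℤ) + h + 1 - 2 * b) * q ^ (b - h - 1) =
          q ^ ((m : ℤ) + 1 - b) := by
        rw [← zpow_add₀ hq]; congr 1; push_cast; ring
      rw [e1, e2, e3, e4]
      linear_combination gaussBinom q m (b - h - 1) * e5
    · rintro (_ | h) b hb
      · simp [ballotSumEast_zero_height]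
      · rw [ballotSumEast_succ_succ, ih (h + 1) b (by push_cast at hb ⊢; omega),
          ihE h (b - 1) (by push_cast at hb ⊢; omega), gaussBinom_succ q m b,
          gaussBinom_succ' hq m (b - (h + 1 : ℕ))]
        have e2 : b - ((h + 1 : ℕ) : ℤ) - 1 = b - h - 1 - 1 := by push_cast; ring
        have e3 : b - 1 - (h : ℤ) = b - h - 1 := by ring
        have e3' : b - ((h + 1 : ℕ) : ℤ) = b - h - 1 := by push_cast; ring
        have e4 : (m : ℤ) - (b - 1) = (m + 1 : ℕ) - b := by push_cast; ring
        have e5 : q ^ (m + 1) = q ^ (((m + 1 : ℕ) : ℤ) - b) * q ^ b := by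
          rw [← zpow_add₀ hq, ← zpow_natCast]; congr 1; ring
        have e6 : q ^ (m + 1) * q ^ ((m : ℤ) + (h + 1 : ℕ) + 1 - 2 * b) =
            q ^ (((m + 1 : ℕ) : ℤ) - b) * q ^ ((m : ℤ) + 1 - (b - h - 1)) := by
          rw [← zpow_natCast, ← zpow_add₀ hq, ← zpow_add₀ hq]; congr 1; push_cast; ring
        rw [e2, e3, e3', e4]
        linear_combination gaussBinom q m b * e5 - gaussBinom q m (b - h - 1 - 1) * e6

lemma pow_mul_ballotSum_zero (hq : q ≠ 0) {m b : ℕ} (hb : 2 * b ≤ m) :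
    q ^ b * ballotSum q m 0 b = gaussBinom q m b - gaussBinom q m (b - 1) := by
  rw [(ballotSum_formulas hq m).1 0 b (by push_cast; omega)]
  have h := one_sub_mul_gaussBinom hq m b
  have e : q ^ (b : ℤ) * q ^ ((m : ℤ) + (0 : ℕ) + 1 - 2 * b) = q ^ ((m : ℤ) + 1 - b) := by
    rw [← zpow_add₀ hq]; congr 1; push_cast; ring
  rw [← zpow_natCast]
  simp only [Nat.cast_zero, sub_zero] at e ⊢
  linear_combination -h - gaussBinom q m (b - 1) * e

lemma sum_pow_mul_ballotSum (hq : q ≠ 0) {m n : ℕ} (hn : 2 * n ≤ m) :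
    ∑ b ∈ Finset.range (n + 1), q ^ b * ballotSum q m 0 b = gaussBinom q m n := by
  induction n with
  | zero =>
    have := pow_mul_ballotSum_zero hq hn
    rw [gaussBinom_of_neg m (show ((0 : ℕ) : ℤ) - 1 < 0 by simp)] at this
    simpa using this
  | succ n ih =>
    rw [Finset.sum_range_succ, ih (by omega), pow_mul_ballotSum_zero hq hn]
    simp

end BallotSum

lemma countN_add_countE_length {m : ℕ} (w : Fin m → Bool) : countN w m + countE w m = m := by
  have h := Finset.card_filter_add_card_filter_not (s := (Finset.univ : Finset (Fin m)))
    (fun t => w t = true)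
  simpa [countN, countE] using h

lemma IsBallot.two_mul_negPath_le {m : ℕ} {w : Fin m → Bool} (hw : IsBallot 0 w) :
    2 * negPath w ≤ m := by
  have h := hw m
  have h' := countN_add_countE_length w
  have e : countE w m = negPath w := by simp [countE, negPath]
  omega

lemma sum_isDyckB {K : Type*} [Field K] {q : K} (hq : q ≠ 0) (n : ℕ) :
    ∑ w ∈ Finset.univ.filter (fun w : Fin (2 * n) → Bool => IsDyckB n w),
      q ^ (negPath w + comaj w) = gaussBinom q (2 * n) n := by
  rw [← sum_pow_mul_ballotSum hq le_rfl]
  simp only [ballotSum, Finset.mul_sum]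
  rw [Finset.sum_comm, Finset.sum_filter]
  refine Finset.sum_congr rfl fun w _ => ?_
  by_cases hw : IsBallot 0 w
  · have hD : IsDyckB n w := hw
    have hle := hw.two_mul_negPath_le
    rw [if_pos hD, Finset.sum_eq_single (negPath w)]
    · simp [hw, pow_add]
    · intro b _ hb
      simp [hb.symm]
    · intro hb
      exact absurd (Finset.mem_range.mpr (by omega)) hb
  · have hD : ¬ IsDyckB n w := hw
    simp [hw, hD]

/-- For every `n ≥ 1`, the generating function of the type `B` major index over
all type `B_n` Dyck paths equals the Gaussian binomial `[2n choose n]`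
evaluated at `q²`, i.e. `∏_{i=1}^n (1 - q^{2(n+i)})/(1 - q^{2i})`. -/
theorem majB_generating_function (n : ℕ) (hn : 1 ≤ n) :
    ∑ w ∈ Finset.univ.filter (fun w : Fin (2 * n) → Bool => IsDyckB n w),
        (RatFunc.X : RatFunc ℚ) ^ majB n w =
      ∏ i ∈ Finset.Icc 1 n,
        (1 - (RatFunc.X : RatFunc ℚ) ^ (2 * (n + i))) /
          (1 - (RatFunc.X : RatFunc ℚ) ^ (2 * i)) := by
  have hq : (RatFunc.X : RatFunc ℚ) ^ 2 ≠ 0 := pow_ne_zero _ RatFunc.X_ne_zero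
  have hq1 : ∀ i : ℕ, 1 ≤ i → ((RatFunc.X : RatFunc ℚ) ^ 2) ^ i ≠ 1 := by
    intro i hi h
    rw [← pow_mul, ← RatFunc.algebraMap_X, ← map_pow,
      ← map_one (algebraMap (Polynomial ℚ) (RatFunc ℚ))] at h
    have h' := congrArg Polynomial.natDegree (RatFunc.algebraMap_injective ℚ h)
    rw [Polynomial.natDegree_X_pow, Polynomial.natDegree_one] at h'
    omega
  simp only [majB, pow_mul]
  rw [← gaussBinom_central hq hq1]
  exact sum_isDyckB hq n

end Stmt
end

section
/- For every n ≥ 1 and every integer k, the number of Dyck paths of length n with major index k equals the number of non-crossing permutations σ of {1,…,n} with maj(σ) + imaj(σ) = k; equivalently, Σ_{w ∈ D_n} q^{maj(w)} = Σ_{σ ∈ NC(n)} q^{maj(σ) + imaj(σ)}. -/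
open scoped Classical

namespace Stmt

/-- Number of inversions of a permutation of `{1,…,n}`. -/
def invP {n : ℕ} (σ : Equiv.Perm (Fin n)) : ℕ :=
  (Finset.univ.filter (fun p : Fin n × Fin n => p.1 < p.2 ∧ σ p.2 < σ p.1)).card

/-- Descent set of a permutation, as 1-indexed positions in `{1,…,n-1}`. -/
def permDes {n : ℕ} (σ : Equiv.Perm (Fin n)) : Finset ℕ :=
  (Finset.Ico 1 n).filter (fun i =>
    ∃ h : i < n, σ ⟨i, h⟩ < σ ⟨i - 1, Nat.lt_of_le_of_lt (Nat.sub_le i 1) h⟩)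

def desP {n : ℕ} (σ : Equiv.Perm (Fin n)) : ℕ := (permDes σ).card

def majP {n : ℕ} (σ : Equiv.Perm (Fin n)) : ℕ := ∑ i ∈ permDes σ, i

def imajP {n : ℕ} (σ : Equiv.Perm (Fin n)) : ℕ := majP σ⁻¹

/-- Every orbit of `σ` is an increasing cycle: each element is mapped to the
next larger element of its orbit, the largest being mapped to the smallest. -/
def IncCycles {n : ℕ} (σ : Equiv.Perm (Fin n)) : Prop :=
  ∀ x : Fin n,
    ((∃ y, σ.SameCycle x y ∧ x < y) →
      x < σ x ∧ ∀ y, σ.SameCycle x y → x < y → σ x ≤ y) ∧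
    ((∀ y, σ.SameCycle x y → y ≤ x) → ∀ y, σ.SameCycle x y → σ x ≤ y)

/-- No two distinct orbits of `σ` cross. -/
def NoCrossing {n : ℕ} (σ : Equiv.Perm (Fin n)) : Prop :=
  ¬ ∃ a b c d : Fin n, a < b ∧ b < c ∧ c < d ∧
      σ.SameCycle a c ∧ σ.SameCycle b d ∧ ¬σ.SameCycle a b

/-- Non-crossing permutations of `{1,…,n}`. -/
def IsNC {n : ℕ} (σ : Equiv.Perm (Fin n)) : Prop := IncCycles σ ∧ NoCrossing σ

/-- Number of elements of `S` below `k`. -/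
def cnt (S : Finset ℕ) (k : ℕ) : ℕ := (S.filter (· < k)).card

theorem cnt_succ (S : Finset ℕ) (k : ℕ) :
    cnt S (k + 1) = cnt S k + if k ∈ S then 1 else 0 := by
  unfold cnt
  split_ifs with h
  · have : S.filter (· < k + 1) = insert k (S.filter (· < k)) := by
      ext x
      simp only [Finset.mem_filter, Finset.mem_insert]
      constructor
      · rintro ⟨h1, h2⟩
        by_cases hx : x = k
        · exact Or.inl hx
        · exact Or.inr ⟨h1, by omega⟩
      · rintro (rfl | ⟨h1, h2⟩)
        · exact ⟨h, by omega⟩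
        · exact ⟨h1, by omega⟩
    rw [this, Finset.card_insert_of_notMem (by simp)]
  · congr 1
    ext x
    simp only [Finset.mem_filter]
    refine and_congr_right fun h1 => ?_
    have : x ≠ k := fun e => h (e ▸ h1)
    omega

theorem cnt_zero (S : Finset ℕ) : cnt S 0 = 0 := by simp [cnt]

theorem cnt_mono (S : Finset ℕ) {j k : ℕ} (h : j ≤ k) : cnt S j ≤ cnt S k :=
  Finset.card_le_card fun x hx => by
    simp only [Finset.mem_filter] at hx ⊢
    exact ⟨hx.1, by omega⟩

theorem cnt_eq_card {S : Finset ℕ} {k : ℕ} (h : ∀ x ∈ S, x < k) : cnt S k = S.card := by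
  unfold cnt
  rw [Finset.filter_true_of_mem h]

theorem cnt_erase (S : Finset ℕ) {i : ℕ} (hi : i ∈ S) (k : ℕ) :
    cnt (S.erase i) k + (if i < k then 1 else 0) = cnt S k := by
  induction k with
  | zero => simp [cnt_zero]
  | succ k ih =>
    rw [cnt_succ, cnt_succ, ← ih]
    by_cases h : i = k
    · subst h; simp [hi]
    · have h2 : i < k + 1 ↔ i < k := by omega
      simp only [h2, Finset.mem_erase, Ne.symm h, ne_eq, not_false_eq_true, true_and]
      omega

/-- The pairs of subsets of `{0,…,n-1}` which arise as the sets of excedances and of excedance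
values of non-crossing permutations. -/
structure IsArcPair (n : ℕ) (U D : Finset ℕ) : Prop where
  card_eq : U.card = D.card
  lt_left : ∀ x ∈ U, x < n
  lt_right : ∀ x ∈ D, x < n
  ballot : ∀ k, cnt D (k + 1) ≤ cnt U k

/-- Non-crossing permutations, described through the intervals spanned by the arcs `x → τ x`. -/
structure IsArcNC (τ : Equiv.Perm ℕ) : Prop where
  up : ∀ x j, x < j → j < τ x → x < τ j ∧ τ j < τ x
  down : ∀ x j, τ x < x → τ x ≤ j → j ≤ x → τ x ≤ τ j ∧ τ j ≤ x

/-- `τ` is a non-crossing permutation of `{0,…,n-1}` with excedance set `U` and set of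
excedance values `D`. -/
structure HasArcs (n : ℕ) (U D : Finset ℕ) (τ : Equiv.Perm ℕ) : Prop extends IsArcNC τ where
  fix : ∀ x, n ≤ x → τ x = x
  mem_left : ∀ x, x ∈ U ↔ x < τ x
  mem_right : ∀ x, τ x ∈ D ↔ x < τ x

theorem mem_of_perm_mem {τ : Equiv.Perm ℕ} {a b : ℕ}
    (h : ∀ j, a ≤ j → j ≤ b → a ≤ τ j ∧ τ j ≤ b) {j : ℕ} (h1 : a ≤ τ j) (h2 : τ j ≤ b) :
    a ≤ j ∧ j ≤ b := by
  have hm : Set.MapsTo τ (Set.Icc a b) (Set.Icc a b) := fun x hx => h x hx.1 hx.2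
  have := Equiv.Perm.perm_symm_mapsTo_of_mapsTo τ hm (show τ j ∈ Set.Icc a b from ⟨h1, h2⟩)
  simpa using this

namespace IsArcNC

variable {τ : Equiv.Perm ℕ}

theorem up_back (h : IsArcNC τ) {x j : ℕ} (h1 : x < τ j) (h2 : τ j < τ x) : x < j ∧ j < τ x := by
  have := mem_of_perm_mem (τ := τ) (a := x + 1) (b := τ x - 1)
    (fun i hi hi' => by have := h.up x i (by omega) (by omega); omega) (j := j)
    (by omega) (by omega)
  omega

theorem down_back (h : IsArcNC τ) {x j : ℕ} (h0 : τ x < x) (h1 : τ x ≤ τ j) (h2 : τ j ≤ x) :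
    τ x ≤ j ∧ j ≤ x :=
  mem_of_perm_mem (fun i hi hi' => h.down x i h0 hi hi') h1 h2

end IsArcNC

theorem HasArcs.lt_of_lt {n : ℕ} {U D : Finset ℕ} {τ : Equiv.Perm ℕ} (h : HasArcs n U D τ)
    {x : ℕ} (hx : x < n) : τ x < n := by
  by_contra hc
  have := τ.injective (h.fix (τ x) (by omega))
  omega

theorem HasArcs.isArcPair {n : ℕ} {U D : Finset ℕ} {τ : Equiv.Perm ℕ} (h : HasArcs n U D τ) :
    IsArcPair n U D where
  card_eq := by
    refine Finset.card_bij (fun x _ => τ x) (fun x hx => ?_) (fun x _ y _ e => τ.injective e)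
      (fun y hy => ⟨τ.symm y, ?_, by simp⟩)
    · exact (h.mem_right x).2 ((h.mem_left x).1 hx)
    · rw [h.mem_left, ← h.mem_right]; simpa using hy
  lt_left x hx := by
    by_contra hc
    have := (h.mem_left x).1 hx
    rw [h.fix x (by omega)] at this
    omega
  lt_right y hy := by
    by_contra hc
    have e := h.fix y (by omega)
    rw [← e, h.mem_right, e] at hy
    omega
  ballot k := by
    refine Finset.card_le_card_of_injOn τ.symm (fun y hy => ?_) (τ.symm.injective.injOn)
    obtain ⟨x, rfl⟩ := τ.surjective y
    simp only [Finset.coe_filter, Set.mem_ofPred_eq, h.mem_right, Equiv.symm_apply_apply,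
      h.mem_left] at hy ⊢
    exact ⟨hy.1, by omega⟩

/-- The opener matched with the final closer `n`. -/
structure IsMatch (n : ℕ) (U D : Finset ℕ) (i : ℕ) : Prop where
  lt : i < n
  eq : cnt D (i + 1) = cnt U i
  gt : ∀ k, i < k → k < n → cnt D (k + 1) < cnt U k

theorem IsMatch.unique {n : ℕ} {U D : Finset ℕ} {i j : ℕ} (hi : IsMatch n U D i)
    (hj : IsMatch n U D j) : i = j := by
  rcases lt_trichotomy i j with h | h | h
  · have := hi.gt j h hj.lt
    have := hj.eq
    omega
  · exact h
  · have := hj.gt i h hi.lt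
    have := hi.eq
    omega

theorem IsArcPair.zero_notMem {n : ℕ} {U D : Finset ℕ} (h : IsArcPair n U D) : 0 ∉ D := by
  intro h0
  have := h.ballot 0
  rw [cnt_succ] at this
  simp [h0, cnt_zero] at this

theorem IsArcPair.last_notMem {n : ℕ} {U D : Finset ℕ} (h : IsArcPair (n + 1) U D) : n ∉ U := by
  intro h0
  have h1 := h.ballot n
  have h2 := cnt_succ U n
  rw [cnt_eq_card h.lt_right] at h1
  rw [cnt_eq_card h.lt_left, if_pos h0] at h2
  have := h.card_eq
  omega

theorem IsArcPair.exists_isMatch {n : ℕ} {U D : Finset ℕ} (h : IsArcPair (n + 1) U D)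
    (hn : n ∈ D) : ∃ i, IsMatch n U D i := by
  have hpos : 0 < n := by
    rcases Nat.eq_zero_or_pos n with rfl | h0
    · exact absurd hn h.zero_notMem
    · exact h0
  have h0 : cnt D (0 + 1) = cnt U 0 := by
    have := h.ballot 0
    rw [cnt_zero] at *
    omega
  let p := fun k => cnt D (k + 1) = cnt U k
  have hs := Nat.findGreatest_spec (P := p) (n := n - 1) (Nat.zero_le _) h0
  have hle := Nat.findGreatest_le (P := p) (n - 1)
  refine ⟨Nat.findGreatest p (n - 1), by omega, hs, fun k hk hkn => ?_⟩
  have := Nat.findGreatest_is_greatest hk (by omega)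
  exact lt_of_le_of_ne (h.ballot k) this

theorem IsMatch.mem {n : ℕ} {U D : Finset ℕ} (h : IsArcPair (n + 1) U D)
    (hn : n ∈ D) {i : ℕ} (hi : IsMatch n U D i) : i ∈ U := by
  by_contra hc
  have h1 := cnt_succ U i
  rw [if_neg hc] at h1
  have h2 := hi.eq
  by_cases hin : i + 1 < n
  · have := hi.gt (i + 1) (by omega) hin
    have := cnt_mono D (show i + 1 ≤ i + 1 + 1 by omega)
    omega
  · have e : i + 1 = n := by have := hi.lt; omega
    rw [e] at h1 h2
    have h3 := cnt_succ D n
    have h4 := cnt_succ U n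
    rw [if_pos hn, cnt_eq_card h.lt_right] at h3
    rw [if_neg h.last_notMem, cnt_eq_card h.lt_left] at h4
    have := h.card_eq
    omega

theorem IsMatch.isArcPair {n : ℕ} {U D : Finset ℕ} (h : IsArcPair (n + 1) U D)
    (hn : n ∈ D) {i : ℕ} (hi : IsMatch n U D i) : IsArcPair n (U.erase i) (D.erase n) where
  card_eq := by
    rw [Finset.card_erase_of_mem (hi.mem h hn), Finset.card_erase_of_mem hn, h.card_eq]
  lt_left x hx := by
    rw [Finset.mem_erase] at hx
    have := h.lt_left x hx.2
    have : x ≠ n := fun e => h.last_notMem (e ▸ hx.2)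
    omega
  lt_right x hx := by
    rw [Finset.mem_erase] at hx
    have := h.lt_right x hx.2
    omega
  ballot k := by
    have h1 := cnt_erase U (hi.mem h hn) k
    have h2 := cnt_erase D hn (k + 1)
    have h3 := h.ballot k
    by_cases hk : i < k
    · rw [if_pos hk] at h1
      by_cases hkn : k < n
      · have := hi.gt k hk hkn
        omega
      · rw [if_pos (by omega)] at h2
        omega
    · rw [if_neg hk] at h1
      omega

/-- Closing a visible block of `τ` with the new element `n`. -/
theorem HasArcs.mul_swap {n : ℕ} {U D : Finset ℕ} {τ : Equiv.Perm ℕ} {i : ℕ}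
    (h : IsArcPair (n + 1) U D) (hn : n ∈ D) (hi : IsMatch n U D i)
    (hτ : HasArcs n (U.erase i) (D.erase n) τ) : HasArcs (n + 1) U D (τ * Equiv.swap i n) := by
  have hin := hi.lt
  have hiU := hi.mem h hn
  have hnU := h.last_notMem
  have hτn : τ n = n := hτ.fix n le_rfl
  have hcard : ((D.erase n).filter (· < i + 1)).card = ((U.erase i).filter (· < i + 1)).card := by
    have h1 := cnt_erase U hiU (i + 1)
    have h2 := cnt_erase D hn (i + 1)
    have h3 := hi.eq
    have h4 := cnt_succ U i
    simp only [hiU, if_true, lt_add_one] at h1 h4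
    rw [if_neg (by omega)] at h2
    unfold cnt at *
    omega
  have hle : ∀ x, x ≤ i → τ x ≤ i := by
    intro x hx
    by_cases hxU : x ∈ U.erase i
    · have hsurj := Finset.surjOn_of_injOn_of_card_le (s := (D.erase n).filter (· < i + 1))
        (t := (U.erase i).filter (· < i + 1)) τ.symm (fun y hy => by
          obtain ⟨z, rfl⟩ := τ.surjective y
          simp only [Finset.coe_filter, Set.mem_ofPred_eq, hτ.mem_right, Equiv.symm_apply_apply,
            hτ.mem_left] at hy ⊢
          exact ⟨hy.1, by omega⟩) τ.symm.injective.injOn hcard.ge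
      obtain ⟨y, hy, e⟩ := hsurj (show x ∈ _ by
        simp only [Finset.coe_filter, Set.mem_ofPred_eq]; exact ⟨hxU, by omega⟩)
      obtain ⟨z, rfl⟩ := τ.surjective y
      simp only [Equiv.symm_apply_apply] at e
      subst e
      simp only [Finset.coe_filter, Set.mem_ofPred_eq] at hy
      omega
    · rw [hτ.mem_left] at hxU
      omega
  have hge : ∀ x, i < x → i < τ x := by
    intro x hx
    by_contra hc
    have := mem_of_perm_mem (τ := τ) (a := 0) (b := i) (fun j _ hj => ⟨by omega, hle j hj⟩)
      (j := x) (by omega) (by omega)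
    omega
  have e1 : (τ * Equiv.swap i n) i = n := by simp [hτn]
  have e2 : (τ * Equiv.swap i n) n = τ i := by simp
  have e3 : ∀ x, x ≠ i → x ≠ n → (τ * Equiv.swap i n) x = τ x := fun x h1 h2 => by
    simp [Equiv.swap_apply_of_ne_of_ne h1 h2]
  have hτi := hle i le_rfl
  have hlt : ∀ x, x < n → τ x < n := fun x => hτ.lt_of_lt
  have hfix := hτ.fix
  have hup := hτ.up
  have hdown := hτ.down
  generalize hτ' : τ * Equiv.swap i n = τ' at *
  refine ⟨⟨?_, ?_⟩, ?_, ?_, ?_⟩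
  · intro x j h1 h2
    by_cases hxi : x = i
    · subst hxi
      rw [e1] at h2 ⊢
      rw [e3 j (by omega) (by omega)]
      exact ⟨hge j h1, hlt j h2⟩
    by_cases hxn : x = n
    · subst hxn; omega
    rw [e3 x hxi hxn] at h2 ⊢
    have hxn' : x < n := by
      by_contra hc
      have := hfix x (by omega)
      omega
    have := hlt x hxn'
    have hji : j ≠ i := by
      rintro rfl
      have := hle x (by omega)
      omega
    rw [e3 j hji (by omega)]
    exact hup x j h1 h2
  · intro x j h0 h1 h2
    by_cases hxi : x = i
    · subst hxi; omega
    by_cases hxn : x = n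
    · subst hxn
      rw [e2] at h0 h1 ⊢
      by_cases hji : j = i
      · subst hji; omega
      by_cases hjn : j = x
      · subst hjn; omega
      rw [e3 j hji hjn]
      have := hlt j (by omega)
      by_cases hj : j ≤ i
      · have := hdown i j (by omega) h1 hj
        omega
      · have := hge j (by omega)
        omega
    rw [e3 x hxi hxn] at h0 h1 ⊢
    have hxn' : x < n := by
      by_contra hc
      have := hfix x (by omega)
      omega
    have hji : j ≠ i := by
      rintro rfl
      have := hge x (by omega)
      omega
    rw [e3 j hji (by omega)]
    exact hdown x j h0 h1 h2
  · intro x hx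
    rw [e3 x (by omega) (by omega)]
    exact hfix x (by omega)
  · intro x
    by_cases hxi : x = i
    · subst hxi; simp [e1, hiU, hin]
    by_cases hxn : x = n
    · subst hxn; simp [e2, hnU]; omega
    rw [e3 x hxi hxn, ← hτ.mem_left]
    simp [hxi]
  · intro x
    by_cases hxi : x = i
    · subst hxi; simp [e1, hn, hin]
    by_cases hxn : x = n
    · subst hxn
      have := hτ.mem_right i
      rw [e2]
      rw [Finset.mem_erase] at this
      have h5 : τ i ≠ x := by omega
      simp only [h5, ne_eq, not_false_eq_true, true_and] at this
      rw [this]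
      omega
    rw [e3 x hxi hxn, ← hτ.mem_right, Finset.mem_erase]
    have : τ x ≠ n := fun e => hxn (τ.injective (e.trans hτn.symm))
    simp [this]

/-- Removing the last element `n`, when it is not a fixed point. -/
theorem HasArcs.mul_swap_symm {n : ℕ} {U D : Finset ℕ} {τ : Equiv.Perm ℕ} {i : ℕ}
    (hn : n ∈ D) (hτ : HasArcs (n + 1) U D τ) (hi : IsMatch n U D i) :
    HasArcs n (U.erase i) (D.erase n) (τ * Equiv.swap i n) := by
  have h := hτ.isArcPair
  obtain ⟨i', hi'⟩ := τ.surjective n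
  have hi'n : i' < n := by
    rw [← hi', hτ.mem_right, hi'] at hn
    exact hn
  have hmatch : IsMatch n U D i' := by
    refine ⟨hi'n, le_antisymm (h.ballot i') ?_, fun k hk hkn => ?_⟩
    · refine Finset.card_le_card_of_injOn τ (fun x hx => ?_) τ.injective.injOn
      simp only [Finset.coe_filter, Set.mem_ofPred_eq, hτ.mem_right, hτ.mem_left] at hx ⊢
      refine ⟨hx.1, ?_⟩
      by_contra hc
      have := hτ.up x i' hx.2 (by omega)
      have := hτ.lt_of_lt (x := x) (by omega)
      omega
    · have hlt : ((U.filter (· < k)).erase i').card < (U.filter (· < k)).card := by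
        apply Finset.card_erase_lt_of_mem
        simp only [Finset.mem_filter, hτ.mem_left]
        omega
      refine lt_of_le_of_lt ?_ hlt
      refine Finset.card_le_card_of_injOn τ.symm (fun y hy => ?_) τ.symm.injective.injOn
      obtain ⟨z, rfl⟩ := τ.surjective y
      simp only [Finset.coe_filter, Set.mem_ofPred_eq, hτ.mem_right, Equiv.symm_apply_apply,
        hτ.mem_left, Finset.coe_erase, Set.mem_sdiff, Set.mem_singleton_iff] at hy ⊢
      refine ⟨⟨hy.1, by omega⟩, ?_⟩
      rintro rfl
      omega
  obtain rfl := hi.unique hmatch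
  have hτn : τ n < n := by
    have h1 := hτ.lt_of_lt (x := n) (by omega)
    have h2 : τ n ≠ n := fun e => by
      have := τ.injective (e.trans hi'.symm)
      omega
    omega
  have hτn' : τ n ≤ i := by
    have := hτ.down_back (x := n) (j := i) hτn (by omega) (by omega)
    omega
  have e1 : (τ * Equiv.swap i n) i = τ n := by simp
  have e2 : (τ * Equiv.swap i n) n = n := by simp [hi']
  have e3 : ∀ x, x ≠ i → x ≠ n → (τ * Equiv.swap i n) x = τ x := fun x h1 h2 => by
    simp [Equiv.swap_apply_of_ne_of_ne h1 h2]
  have hfix := hτ.fix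
  have hup := hτ.up
  have hdown := hτ.down
  have hinj : ∀ x, x ≠ i → τ x ≠ n := fun x hx e => hx (τ.injective (e.trans hi'.symm))
  have hlt := fun x => hτ.lt_of_lt (x := x)
  generalize hτ' : τ * Equiv.swap i n = τ' at *
  refine ⟨⟨?_, ?_⟩, ?_, ?_, ?_⟩
  · intro x j h1 h2
    by_cases hxi : x = i
    · subst hxi; omega
    by_cases hxn : x = n
    · subst hxn; omega
    rw [e3 x hxi hxn] at h2 ⊢
    have hxn' : x < n + 1 := by
      by_contra hc
      have := hfix x (by omega)
      omega
    have := hlt x hxn'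
    have hji : j ≠ i := by
      rintro rfl
      have := hup x j h1 h2
      omega
    rw [e3 j hji (by omega)]
    exact hup x j h1 h2
  · intro x j h0 h1 h2
    by_cases hxi : x = i
    · subst hxi
      rw [e1] at h0 h1 ⊢
      by_cases hji : j = x
      · subst hji; omega
      rw [e3 j hji (by omega)]
      have := hdown n j hτn h1 (by omega)
      refine ⟨this.1, ?_⟩
      by_contra hc
      have := hup j x (by omega) (by omega)
      omega
    by_cases hxn : x = n
    · subst hxn; omega
    rw [e3 x hxi hxn] at h0 h1 ⊢
    have hxn' : x < n + 1 := by
      by_contra hc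
      have := hfix x (by omega)
      omega
    have hji : j ≠ i := by
      rintro rfl
      have := hdown x j h0 h1 h2
      omega
    rw [e3 j hji (by omega)]
    exact hdown x j h0 h1 h2
  · intro x hx
    by_cases hxn : x = n
    · subst hxn; exact e2
    rw [e3 x (by omega) hxn]
    exact hfix x (by omega)
  · intro x
    by_cases hxi : x = i
    · subst hxi; simp [e1, hτn']
    by_cases hxn : x = n
    · subst hxn; simp [e2, h.last_notMem]
    rw [e3 x hxi hxn, ← hτ.mem_left]
    simp [hxi]
  · intro x
    by_cases hxi : x = i
    · subst hxi
      have := hτ.mem_right n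
      rw [e1, Finset.mem_erase, this]
      omega
    by_cases hxn : x = n
    · subst hxn
      simp [e2]
    rw [e3 x hxi hxn, ← hτ.mem_right, Finset.mem_erase]
    simp [hinj x hxi]

theorem existsUnique_hasArcs (n : ℕ) : ∀ U D : Finset ℕ, IsArcPair n U D →
    ∃! τ : Equiv.Perm ℕ, HasArcs n U D τ := by
  induction n with
  | zero =>
    intro U D h
    refine ⟨1, ⟨⟨fun x j h1 h2 => ?_, fun x j h0 => ?_⟩, fun x _ => rfl, fun x => ?_, fun x => ?_⟩,
      fun τ hτ => ?_⟩
    · simp at h2; omega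
    · simp at h0
    · simp; exact fun hx => by have := h.lt_left x hx; omega
    · simp; exact fun hx => by have := h.lt_right x hx; omega
    · ext x; simpa using hτ.fix x (Nat.zero_le x)
  | succ n ih =>
    intro U D h
    by_cases hn : n ∈ D
    · obtain ⟨i, hi⟩ := h.exists_isMatch hn
      obtain ⟨τ, hτ, huniq⟩ := ih _ _ (hi.isArcPair h hn)
      refine ⟨τ * Equiv.swap i n, hτ.mul_swap h hn hi, fun τ' hτ' => ?_⟩
      rw [← huniq _ (hτ'.mul_swap_symm hn hi), mul_assoc, Equiv.swap_mul_self, mul_one]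
    · have hp : IsArcPair n U D := by
        refine ⟨h.card_eq, fun x hx => ?_, fun x hx => ?_, h.ballot⟩
        · have := h.lt_left x hx
          have : x ≠ n := fun e => h.last_notMem (e ▸ hx)
          omega
        · have := h.lt_right x hx
          have : x ≠ n := fun e => hn (e ▸ hx)
          omega
      obtain ⟨τ, hτ, huniq⟩ := ih _ _ hp
      refine ⟨τ, ⟨hτ.toIsArcNC, fun x hx => hτ.fix x (by omega), hτ.mem_left, hτ.mem_right⟩,
        fun τ' hτ' => huniq _ ⟨hτ'.toIsArcNC, fun x hx => ?_, hτ'.mem_left, hτ'.mem_right⟩⟩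
      by_cases hxn : x = n
      · subst hxn
        obtain ⟨y, hy⟩ := τ'.surjective x
        have h1 := hτ'.mem_right y
        rw [hy] at h1
        by_contra hc
        have h2 : y ≠ x := fun e => hc (e ▸ hy)
        have h3 : x + 1 ≤ y := by
          have : ¬ y < x := fun h' => hn (h1.2 h')
          omega
        have := hτ'.fix y h3
        omega
      · exact hτ'.fix x (by omega)

/-- The extension of a permutation of `{0,…,n-1}` to the natural numbers. -/
def natPerm {n : ℕ} (σ : Equiv.Perm (Fin n)) : Equiv.Perm ℕ :=
  σ.extendDomain Fin.equivSubtype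

theorem natPerm_coe {n : ℕ} (σ : Equiv.Perm (Fin n)) (x : Fin n) : natPerm σ x = σ x :=
  Equiv.Perm.extendDomain_apply_image σ Fin.equivSubtype x

theorem natPerm_of_le {n : ℕ} (σ : Equiv.Perm (Fin n)) {x : ℕ} (hx : n ≤ x) : natPerm σ x = x :=
  Equiv.Perm.extendDomain_apply_not_subtype σ Fin.equivSubtype (by omega)

theorem natPerm_inv {n : ℕ} (σ : Equiv.Perm (Fin n)) : natPerm σ⁻¹ = (natPerm σ).symm := rfl

theorem natPerm_injective {n : ℕ} : Function.Injective (natPerm (n := n)) := by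
  intro σ τ h
  ext x
  rw [← natPerm_coe, ← natPerm_coe, h]

theorem exists_natPerm_eq {n : ℕ} {τ : Equiv.Perm ℕ} (h : ∀ x, n ≤ x → τ x = x) :
    ∃ σ : Equiv.Perm (Fin n), natPerm σ = τ := by
  have h1 : ∀ x, x < n → τ x < n := fun x hx => by
    by_contra hc
    have := τ.injective (h (τ x) (by omega))
    omega
  have h2 : ∀ x, x < n → τ.symm x < n := fun x hx => by
    by_contra hc
    have := h (τ.symm x) (by omega)
    rw [Equiv.apply_symm_apply] at this
    omega
  refine ⟨⟨fun x => ⟨τ x, h1 x x.2⟩, fun x => ⟨τ.symm x, h2 x x.2⟩, fun x => by simp,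
    fun x => by simp⟩, ?_⟩
  ext x
  by_cases hx : x < n
  · exact natPerm_coe _ ⟨x, hx⟩
  · rw [natPerm_of_le _ (by omega), h x (by omega)]

theorem IsNC.up {n : ℕ} {σ : Equiv.Perm (Fin n)} (h : IsNC σ) {x j : Fin n} (h1 : x < j)
    (h2 : j < σ x) : x < σ j ∧ σ j < σ x := by
  obtain ⟨hc, hn⟩ := h
  have hx : σ.SameCycle x (σ x) := (Equiv.Perm.SameCycle.refl σ x).apply_right
  have hj : σ.SameCycle j (σ j) := (Equiv.Perm.SameCycle.refl σ j).apply_right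
  have hxj : ¬ σ.SameCycle x j := fun hs =>
    absurd (((hc x).1 ⟨σ x, hx, h1.trans h2⟩).2 j hs h1) (not_le.2 h2)
  have e1 : σ j ≠ x := fun e => hxj (e ▸ hj).symm
  have e2 : σ j ≠ σ x := fun e => h1.ne' (σ.injective e)
  constructor
  · by_contra hlt
    exact hn ⟨σ j, x, j, σ x, lt_of_le_of_ne (not_lt.1 hlt) e1, h1, h2, hj.symm, hx,
      fun hs => hxj (hj.trans hs).symm⟩
  · by_contra hlt
    exact hn ⟨x, j, σ x, σ j, h1, h2, lt_of_le_of_ne (not_lt.1 hlt) e2.symm, hx, hj, hxj⟩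

theorem IsNC.down {n : ℕ} {σ : Equiv.Perm (Fin n)} (h : IsNC σ) {x j : Fin n} (h0 : σ x < x)
    (h1 : σ x ≤ j) (h2 : j ≤ x) : σ x ≤ σ j ∧ σ j ≤ x := by
  obtain ⟨hc, hn⟩ := h
  have hx : σ.SameCycle x (σ x) := (Equiv.Perm.SameCycle.refl σ x).apply_right
  have hj : σ.SameCycle j (σ j) := (Equiv.Perm.SameCycle.refl σ j).apply_right
  have hmax : ∀ y, σ.SameCycle x y → y ≤ x := fun y hy => by
    by_contra hlt
    exact absurd ((hc x).1 ⟨y, hy, not_le.1 hlt⟩).1 h0.not_gt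
  have hmin := (hc x).2 hmax
  by_cases hs : σ.SameCycle x j
  · exact ⟨hmin _ (hs.trans hj), hmax _ (hs.trans hj)⟩
  have h1' : σ x < j := lt_of_le_of_ne h1 fun e => hs (e ▸ hx)
  have h2' : j < x := lt_of_le_of_ne h2 fun e => hs (e ▸ Equiv.Perm.SameCycle.refl σ j)
  constructor
  · by_contra hlt
    exact hn ⟨σ j, σ x, j, x, not_le.1 hlt, h1', h2', hj.symm, hx.symm,
      fun h' => hs ((hj.trans h').trans hx.symm).symm⟩
  · by_contra hlt
    exact hn ⟨σ x, j, x, σ j, h1', h2', not_le.1 hlt, hx.symm, hj, fun h' => hs (hx.trans h')⟩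

theorem sameCycle_mem {α : Type*} [Finite α] {σ : Equiv.Perm α} {s : Set α}
    (hs : Set.MapsTo σ s s) {x y : α} (hx : x ∈ s) (h : σ.SameCycle x y) : y ∈ s := by
  obtain ⟨i, rfl⟩ := h.exists_nat_pow_eq
  rw [Equiv.Perm.coe_pow]
  exact hs.iterate i hx

theorem isNC_of_up_of_down {n : ℕ} {σ : Equiv.Perm (Fin n)}
    (hup : ∀ x j, x < j → j < σ x → x < σ j ∧ σ j < σ x)
    (hdown : ∀ x j, σ x < x → σ x ≤ j → j ≤ x → σ x ≤ σ j ∧ σ j ≤ x) : IsNC σ := by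
  have hIoo : ∀ x, Set.MapsTo σ (Set.Ioo x (σ x)) (Set.Ioo x (σ x)) :=
    fun x j hj => hup x j hj.1 hj.2
  have hIcc : ∀ x, σ x < x → Set.MapsTo σ (Set.Icc (σ x) x) (Set.Icc (σ x) x) :=
    fun x h0 j hj => hdown x j h0 hj.1 hj.2
  have hinc : IncCycles σ := by
    intro x
    refine ⟨fun ⟨y, hy, hxy⟩ => ?_, fun hmax y hy => ?_⟩
    · constructor
      · by_contra hlt
        rcases (not_lt.1 hlt).lt_or_eq with h0 | h0
        · exact absurd (sameCycle_mem (hIcc x h0) ⟨h0.le, le_rfl⟩ hy).2 (not_le.2 hxy)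
        · exact hxy.ne (sameCycle_mem (s := {x}) (fun z hz => by
            rw [Set.mem_singleton_iff] at hz ⊢; rw [hz, h0]) rfl hy).symm
      · intro z hz hxz
        by_contra hlt
        exact absurd (sameCycle_mem (hIoo x) ⟨hxz, not_le.1 hlt⟩ hz.symm).1 (lt_irrefl x)
    · have hle := hmax (σ x) (Equiv.Perm.SameCycle.refl σ x).apply_right
      rcases hle.lt_or_eq with h0 | h0
      · exact (sameCycle_mem (hIcc x h0) ⟨h0.le, le_rfl⟩ hy).1
      · have : y = x := sameCycle_mem (s := {x}) (fun z hz => by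
            rw [Set.mem_singleton_iff] at hz ⊢; rw [hz, h0]) rfl hy
        rw [this, h0]
  refine ⟨hinc, ?_⟩
  rintro ⟨a, b, c, d, hab, hbc, hcd, hac, hbd, hnab⟩
  obtain ⟨x, hx, hmax⟩ := (Finset.univ.filter fun x => σ.SameCycle a x ∧ x < b).exists_max_image id
    ⟨a, by simp [hab, Equiv.Perm.SameCycle.refl]⟩
  simp only [Finset.mem_filter, Finset.mem_univ, true_and, id] at hx hmax
  have hσx := (hinc x).1 ⟨c, hx.1.symm.trans hac, hx.2.trans hbc⟩
  have hσc := hσx.2 c (hx.1.symm.trans hac) (hx.2.trans hbc)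
  have hax : σ.SameCycle a (σ x) := hx.1.apply_right
  have hb : b < σ x := by
    refine lt_of_le_of_ne ?_ fun e => hnab (e ▸ hax)
    by_contra hlt
    exact absurd (hmax _ ⟨hax, not_le.1 hlt⟩) (not_le.2 hσx.1)
  exact absurd (sameCycle_mem (hIoo x) ⟨hx.2, hb⟩ hbd).2 (not_lt.2 (hσc.trans hcd.le))

theorem isNC_iff {n : ℕ} (σ : Equiv.Perm (Fin n)) : IsNC σ ↔ IsArcNC (natPerm σ) := by
  constructor
  · intro h
    refine ⟨fun x j h1 h2 => ?_, fun x j h0 h1 h2 => ?_⟩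
    · by_cases hx : x < n
      · lift x to Fin n using hx
        rw [natPerm_coe] at h2
        have hj : j < n := h2.trans (σ x).2
        lift j to Fin n using hj
        simp only [natPerm_coe] at *
        exact h.up h1 h2
      · rw [natPerm_of_le σ (by omega)] at h2
        omega
    · by_cases hx : x < n
      · lift x to Fin n using hx
        have hj : j < n := lt_of_le_of_lt h2 x.2
        lift j to Fin n using hj
        simp only [natPerm_coe] at *
        exact h.down h0 h1 h2
      · rw [natPerm_of_le σ (by omega)] at h0
        omega
  · intro h
    refine isNC_of_up_of_down (fun x j h1 h2 => ?_) (fun x j h0 h1 h2 => ?_)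
    · have := h.up x j h1 (by rw [natPerm_coe]; exact h2)
      simp only [natPerm_coe] at this
      exact this
    · have := h.down x j (by rw [natPerm_coe]; exact h0) (by rw [natPerm_coe]; exact h1) h2
      simp only [natPerm_coe] at this
      exact this

/-- Pairs of equinumerous subsets of `{0,…,m-1}`, the first one being componentwise at most the
second one. -/
structure IsBallot_s7 (m : ℕ) (p : Finset ℕ × Finset ℕ) : Prop where
  card_eq : p.1.card = p.2.card
  lt_left : ∀ x ∈ p.1, x < m
  lt_right : ∀ x ∈ p.2, x < m
  ballot : ∀ k, cnt p.2 k ≤ cnt p.1 k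

theorem cnt_image_succ (B : Finset ℕ) (k : ℕ) : cnt (B.image Nat.succ) (k + 1) = cnt B k := by
  induction k with
  | zero => rw [cnt_succ]; simp [cnt_zero]
  | succ k ih => rw [cnt_succ, ih, cnt_succ]; simp

theorem isArcPair_image_succ_iff {m : ℕ} {A B : Finset ℕ} :
    IsArcPair (m + 1) A (B.image Nat.succ) ↔ IsBallot_s7 m (A, B) := by
  have hcard := Finset.card_image_of_injective B Nat.succ_injective
  constructor
  · intro h
    refine ⟨h.card_eq.trans hcard, fun x hx => ?_, fun x hx => ?_, fun k => ?_⟩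
    · have := h.lt_left x hx
      have : x ≠ m := fun e => h.last_notMem (e ▸ hx)
      omega
    · have := h.lt_right _ (Finset.mem_image_of_mem Nat.succ hx)
      omega
    · have := h.ballot k
      rwa [cnt_image_succ] at this
  · intro h
    refine ⟨h.card_eq.trans hcard.symm, fun x hx => ?_, fun x hx => ?_, fun k => ?_⟩
    · have := h.lt_left x hx
      omega
    · obtain ⟨y, hy, rfl⟩ := Finset.mem_image.1 hx
      have := h.lt_right y hy
      omega
    · rw [cnt_image_succ]
      exact h.ballot k

/-- The set of excedances and the shifted set of excedance values. -/
noncomputable def arcPair {n : ℕ} (σ : Equiv.Perm (Fin n)) : Finset ℕ × Finset ℕ :=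
  ((Finset.range n).filter (fun x => x < natPerm σ x),
    ((Finset.range n).filter (fun x => x < natPerm σ x)).image fun x => natPerm σ x - 1)

theorem hasArcs_arcPair {n : ℕ} {σ : Equiv.Perm (Fin n)} (h : IsNC σ) :
    HasArcs n (arcPair σ).1 ((arcPair σ).2.image Nat.succ) (natPerm σ) where
  toIsArcNC := (isNC_iff σ).1 h
  fix x hx := natPerm_of_le σ hx
  mem_left x := by
    simp only [arcPair, Finset.mem_filter, Finset.mem_range, and_iff_right_iff_imp]
    intro hx
    by_contra hc
    rw [natPerm_of_le σ (by omega)] at hx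
    omega
  mem_right x := by
    simp only [arcPair, Finset.mem_image, Finset.mem_filter, Finset.mem_range,
      exists_exists_and_eq_and]
    constructor
    · rintro ⟨y, ⟨hy, hlt⟩, e⟩
      have : natPerm σ y = natPerm σ x := by omega
      rwa [← (natPerm σ).injective this]
    · intro hx
      refine ⟨x, ⟨?_, hx⟩, by omega⟩
      by_contra hc
      rw [natPerm_of_le σ (by omega)] at hx
      omega

theorem bijOn_arcPair (m : ℕ) :
    Set.BijOn arcPair {σ : Equiv.Perm (Fin (m + 1)) | IsNC σ} {p | IsBallot_s7 m p} := by
  refine ⟨fun σ hσ => isArcPair_image_succ_iff.1 (hasArcs_arcPair hσ).isArcPair,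
    fun σ hσ τ hτ e => ?_, fun p hp => ?_⟩
  · have h1 := hasArcs_arcPair hσ
    have h2 := hasArcs_arcPair hτ
    rw [← e] at h2
    exact natPerm_injective ((existsUnique_hasArcs _ _ _ h1.isArcPair).unique h1 h2)
  · obtain ⟨τ, hτ, -⟩ := existsUnique_hasArcs _ _ _ (isArcPair_image_succ_iff.2 hp)
    obtain ⟨σ, rfl⟩ := exists_natPerm_eq hτ.fix
    have hσ : IsNC σ := (isNC_iff σ).2 hτ.toIsArcNC
    have h1 := hasArcs_arcPair hσ
    refine ⟨σ, hσ, Prod.ext ?_ (Finset.image_injective Nat.succ_injective ?_)⟩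
    · ext x
      rw [hτ.mem_left, h1.mem_left]
    · ext y
      obtain ⟨x, rfl⟩ := (natPerm σ).surjective y
      rw [hτ.mem_right, h1.mem_right]

theorem IsArcNC.des_iff {τ : Equiv.Perm ℕ} (h : IsArcNC τ) (x : ℕ) :
    τ (x + 1) < τ x ↔ (x < τ x ∧ ¬ τ.symm (x + 1) < x + 1) ∨
      (τ.symm (x + 1) < x + 1 ∧ ¬ x + 1 < τ (x + 1)) := by
  obtain ⟨q, hq⟩ : ∃ q, τ q = x + 1 := τ.surjective _
  rw [← hq, Equiv.symm_apply_apply, hq]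
  have hinj : ∀ a b, τ a = τ b → a = b := fun a b e => τ.injective e
  have hxx := hinj x (x + 1)
  have hqx := hinj q x
  have hqx' := hinj q (x + 1)
  by_cases hu : x < τ x
  · by_cases e : τ x = x + 1
    · have := hinj x q (by omega)
      omega
    · have h1 := h.up x (x + 1) (by omega) (by omega)
      have h2 := h.up q x
      have h3 : q ≠ x := by rintro rfl; omega
      omega
  · by_cases hu' : x + 1 < τ (x + 1)
    · omega
    · by_cases e : τ (x + 1) = x + 1
      · have := hinj q (x + 1) (by omega)
        omega
      · have h1 := h.down (x + 1) x (by omega) (by omega) (by omega)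
        have h2 := h.down_back (x := x + 1) (j := q) (by omega) (by omega) (by omega)
        have h3 : q ≠ x + 1 := by rintro rfl; omega
        omega

theorem IsArcNC.ides_iff {τ : Equiv.Perm ℕ} (h : IsArcNC τ) (x : ℕ) :
    τ.symm (x + 1) < τ.symm x ↔ (x < τ x ∧ ¬ τ.symm x < x) ∨
      (¬ x < τ x ∧ τ.symm (x + 1) < x + 1) := by
  obtain ⟨q, hq⟩ : ∃ q, τ q = x + 1 := τ.surjective _
  obtain ⟨p, hp⟩ : ∃ p, τ p = x := τ.surjective _
  have e1 : τ.symm (x + 1) = q := by rw [← hq, Equiv.symm_apply_apply]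
  have e2 : τ.symm x = p := by rw [← hp, Equiv.symm_apply_apply]
  rw [e1, e2]
  have hpq : p ≠ q := by rintro rfl; omega
  have hpx : p = x → τ x = x := by rintro rfl; exact hp
  have hqx : q = x → τ x = x + 1 := by rintro rfl; exact hq
  have hxp : τ x = x → p = x := fun e => τ.injective (hp.trans e.symm)
  by_cases hu : x < τ x
  · by_cases hd : p < x
    · have := h.up q x
      omega
    · have := h.down_back (x := p) (j := q) (by omega) (by omega) (by omega)
      omega
  · by_cases hd : q < x + 1
    · have := h.up_back (x := q) (j := p) (by omega) (by omega)
      omega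
    · by_cases e : τ x = x
      · have := hxp e
        omega
      · have := h.down_back (x := x) (j := p) (by omega) (by omega) (by omega)
        omega

theorem majP_eq {m : ℕ} (σ : Equiv.Perm (Fin (m + 1))) :
    majP σ = ∑ x ∈ Finset.range m,
      (x + 1) * if natPerm σ (x + 1) < natPerm σ x then 1 else 0 := by
  rw [majP, permDes, Finset.sum_filter, Finset.sum_Ico_eq_sum_range]
  refine Finset.sum_congr (by simp) fun x hx => ?_
  have hx' : x < m := by simpa using hx
  have h1 := natPerm_coe σ ⟨x, by omega⟩
  have h2 := natPerm_coe σ ⟨1 + x, by omega⟩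
  simp only at h1 h2
  rw [add_comm x 1, h1, h2]
  have : ∀ h, (⟨1 + x - 1, h⟩ : Fin (m + 1)) = ⟨x, by omega⟩ := fun h => by simp
  have h3 : 1 + x < m + 1 := by omega
  simp only [this, h3, exists_true_left, mul_ite, mul_one, mul_zero, Fin.lt_def]

/-- Sum of the positions of the valleys of the lattice path encoded by a pair of sets. -/
noncomputable def valleyWeight (m : ℕ) (p : Finset ℕ × Finset ℕ) : ℕ :=
  ∑ x ∈ Finset.range m, ((2 * x + 2) * (if x ∉ p.1 ∧ x ∉ p.2 then 1 else 0) +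
    (2 * x + 3) * (if x ∈ p.2 ∧ x + 1 ∈ p.1 then 1 else 0))

theorem sum_adjacent (T : ℕ → ℕ) (h0 : T 0 = 0) (m : ℕ) :
    ∑ x ∈ Finset.range m, (x + 1) * (T x + T (x + 1)) + (m + 1) * T m =
      ∑ x ∈ Finset.range m, (2 * x + 3) * T (x + 1) := by
  induction m with
  | zero => simp [h0]
  | succ m ih =>
    rw [Finset.sum_range_succ, Finset.sum_range_succ, ← ih]
    ring

theorem majP_add_imajP {m : ℕ} {σ : Equiv.Perm (Fin (m + 1))} (h : IsNC σ) :
    majP σ + imajP σ + valleyWeight m (arcPair σ) = m * (m + 1) := by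
  have hA := hasArcs_arcPair h
  have hb := (bijOn_arcPair m).1 h
  set τ := natPerm σ
  set A := (arcPair σ).1
  set B := (arcPair σ).2
  set T : ℕ → ℕ := fun x => if x ∈ A ∧ x ∈ B.image Nat.succ then 1 else 0
  have hT := sum_adjacent T (by simp [T]) m
  have hTm : T m = 0 := by
    have : m ∉ A := fun hm => by have := hb.lt_left m hm; omega
    simp [T, this]
  have hsum : ∑ x ∈ Finset.range m, (2 * x + 2) = m * (m + 1) := by
    clear * -
    induction m with
    | zero => simp
    | succ m ih => rw [Finset.sum_range_succ, ih]; ring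
  have hright : ∀ x, x ∈ B.image Nat.succ ↔ τ.symm x < x := fun x => by
    obtain ⟨y, rfl⟩ := τ.surjective x
    rw [hA.mem_right, Equiv.symm_apply_apply]
  rw [hTm, mul_zero, add_zero] at hT
  rw [imajP, majP_eq, majP_eq, valleyWeight, Finset.sum_add_distrib (s := Finset.range m),
    natPerm_inv, ← hsum]
  have hT' : ∑ x ∈ Finset.range m, (2 * x + 3) * (if x ∈ B ∧ x + 1 ∈ A then 1 else 0) =
      ∑ x ∈ Finset.range m, (2 * x + 3) * T (x + 1) := by
    refine Finset.sum_congr rfl fun x _ => ?_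
    simp [T, and_comm]
  rw [hT', ← hT, ← Finset.sum_add_distrib, ← Finset.sum_add_distrib, ← Finset.sum_add_distrib]
  refine Finset.sum_congr rfl fun x _ => ?_
  have e1 := hA.des_iff x
  have e2 := hA.ides_iff x
  have hB : x ∈ (arcPair σ).2 ↔ τ.symm (x + 1) < x + 1 := by rw [← hright]; simp [B]
  simp only [T, A, hA.mem_left, hright, hB]
  change (x + 1) * (if τ (x + 1) < τ x then 1 else 0) +
    (x + 1) * (if τ.symm (x + 1) < τ.symm x then 1 else 0) + _ = _
  rw [if_congr e1 rfl rfl, if_congr e2 rfl rfl]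
  by_cases h1 : x < τ x <;> by_cases h2 : τ.symm x < x <;>
    by_cases h3 : x + 1 < τ (x + 1) <;> by_cases h4 : τ.symm (x + 1) < x + 1 <;>
    simp only [h1, h2, h3, h4, not_true, not_false_iff, and_self, and_true, and_false,
      or_true, or_false, or_self, if_true, if_false] <;> ring

theorem cnt_succ_of_mem {S : Finset ℕ} {k : ℕ} (h : k ∈ S) : cnt S (k + 1) = cnt S k + 1 := by
  rw [cnt_succ, if_pos h]

theorem cnt_succ_of_notMem {S : Finset ℕ} {k : ℕ} (h : k ∉ S) : cnt S (k + 1) = cnt S k := by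
  rw [cnt_succ, if_neg h, add_zero]

theorem cnt_le_add (S : Finset ℕ) (j d : ℕ) : cnt S (j + d) ≤ cnt S j + d := by
  induction d with
  | zero => rfl
  | succ d ih =>
    have := cnt_succ S (j + d)
    split_ifs at this <;> rw [← add_assoc] <;> omega

theorem cnt_lt_of_mem {S : Finset ℕ} {i j : ℕ} (hi : i ∈ S) (hij : i < j) : cnt S i < cnt S j := by
  have h1 := cnt_succ_of_mem hi
  have h2 := cnt_mono S (show i + 1 ≤ j from hij)
  omega

theorem cnt_lt_add_of_notMem {S : Finset ℕ} {i j : ℕ} (hj : j - 1 ∉ S) (hij : i < j) :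
    cnt S j + i < cnt S i + j := by
  obtain ⟨d, rfl⟩ := Nat.exists_eq_add_of_lt hij
  have h1 := cnt_succ_of_notMem hj
  have h2 := cnt_le_add S i d
  simp only [Nat.add_sub_cancel] at h1
  omega

theorem cnt_congr {S T : Finset ℕ} {k : ℕ} (h : ∀ j < k, j ∈ S ↔ j ∈ T) : cnt S k = cnt T k := by
  unfold cnt
  congr 1
  ext j
  simp only [Finset.mem_filter]
  exact ⟨fun hj => ⟨(h j hj.2).1 hj.1, hj.2⟩, fun hj => ⟨(h j hj.2).2 hj.1, hj.2⟩⟩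

theorem cnt_eq_of_forall_notMem {S : Finset ℕ} {i j : ℕ} (hij : i ≤ j)
    (h : ∀ x, i ≤ x → x < j → x ∉ S) : cnt S j = cnt S i := by
  unfold cnt
  congr 1
  ext x
  simp only [Finset.mem_filter]
  refine ⟨fun hx => ⟨hx.1, ?_⟩, fun hx => ⟨hx.1, by omega⟩⟩
  by_contra hc
  exact h x (by omega) hx.2 hx.1

theorem cnt_image {D : Finset ℕ} {f : ℕ → ℕ} (hf : Set.InjOn f D) (k : ℕ) :
    cnt (D.image f) k = (D.filter fun i => f i < k).card := by
  rw [cnt, Finset.filter_image, Finset.card_image_of_injOn]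
  exact hf.mono fun x hx => (Finset.mem_filter.1 hx).1

/-- The positions (counted from `0`) of the north steps of a path. -/
def north {M : ℕ} (w : Fin M → Bool) : Finset ℕ :=
  (Finset.univ.filter fun t => w t = true).map Fin.valEmbedding

theorem mem_north {M : ℕ} (w : Fin M → Bool) {x : ℕ} (hx : x < M) :
    x ∈ north w ↔ w ⟨x, hx⟩ = true := by
  simp only [north, Finset.mem_map, Finset.mem_filter, Finset.mem_univ, true_and,
    Fin.valEmbedding_apply]
  exact ⟨fun ⟨t, ht, e⟩ => by subst e; exact ht, fun h => ⟨_, h, rfl⟩⟩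

theorem lt_of_mem_north {M : ℕ} {w : Fin M → Bool} {x : ℕ} (hx : x ∈ north w) : x < M := by
  simp only [north, Finset.mem_map, Fin.valEmbedding_apply] at hx
  obtain ⟨t, -, rfl⟩ := hx
  exact t.2

theorem countN_eq {M : ℕ} (w : Fin M → Bool) (k : ℕ) : countN w k = cnt (north w) k := by
  rw [cnt, north, Finset.filter_map, Finset.card_map, Finset.filter_filter, countN]
  congr 1
  ext t
  simp [and_comm]

theorem countN_add_countE {M : ℕ} (w : Fin M → Bool) {k : ℕ} (hk : k ≤ M) :
    countN w k + countE w k = k := by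
  have h := Finset.card_filter_add_card_filter_not
    (s := Finset.univ.filter fun t : Fin M => (t : ℕ) < k) (fun t => w t = true)
  simp only [Finset.filter_filter, Bool.not_eq_true] at h
  rw [countN, countE, h, Fin.card_filter_val_lt, min_eq_right hk]

/-- The sets of positions of north steps of Dyck paths of length `m + 1`. -/
structure IsDyckSet (m : ℕ) (S : Finset ℕ) : Prop where
  lt : ∀ x ∈ S, x < 2 * (m + 1)
  card : S.card = m + 1
  ballot : ∀ k ≤ 2 * (m + 1), k ≤ 2 * cnt S k

theorem isDyckA_iff {m : ℕ} (w : Fin (2 * (m + 1)) → Bool) :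
    IsDyckA (m + 1) w ↔ IsDyckSet m (north w) := by
  have hc : cnt (north w) (2 * (m + 1)) = (north w).card :=
    cnt_eq_card fun x hx => lt_of_mem_north hx
  constructor
  · rintro ⟨h1, h2⟩
    refine ⟨fun x hx => lt_of_mem_north hx, by rw [← hc, ← countN_eq, h1], fun k hk => ?_⟩
    have h3 := countN_add_countE w hk
    have h4 := h2 k
    rw [← countN_eq]
    omega
  · intro h
    refine ⟨by rw [countN_eq, hc, h.card], fun k => ?_⟩
    rcases le_total k (2 * (m + 1)) with hk | hk
    · have h3 := countN_add_countE w hk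
      have h4 := h.ballot k hk
      rw [← countN_eq] at h4
      omega
    · have h3 := countN_add_countE w le_rfl
      have h4 := h.ballot _ le_rfl
      rw [← countN_eq] at h4
      have e1 : countE w k = countE w (2 * (m + 1)) := by
        unfold countE
        congr 1
        ext t
        have := t.2
        simp only [Finset.mem_filter, Finset.mem_univ, true_and, and_congr_left_iff]
        omega
      have e2 := cnt_mono (north w) hk
      rw [← countN_eq, ← countN_eq] at e2
      omega

theorem bijOn_north (m : ℕ) :
    Set.BijOn north {w : Fin (2 * (m + 1)) → Bool | IsDyckA (m + 1) w} {S | IsDyckSet m S} := by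
  refine ⟨fun w hw => (isDyckA_iff w).1 hw, fun w _ w' _ e => ?_, fun S hS => ?_⟩
  · ext t
    rw [Bool.eq_iff_iff, ← mem_north w t.2, ← mem_north w' t.2, e]
  · have e : north (fun t : Fin (2 * (m + 1)) => decide ((t : ℕ) ∈ S)) = S := by
      ext x
      by_cases hx : x < 2 * (m + 1)
      · rw [mem_north _ hx]
        simp
      · exact iff_of_false (fun h => hx (lt_of_mem_north h)) fun h => hx (hS.lt x h)
    exact ⟨_, (isDyckA_iff _).2 (by rw [e]; exact hS), e⟩

/-- The positions of the valleys of the path with set of north steps `S`. -/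
noncomputable def valleys (S : Finset ℕ) : Finset ℕ := S.filter fun i => 0 < i ∧ i - 1 ∉ S

theorem mem_valleys {S : Finset ℕ} {i : ℕ} : i ∈ valleys S ↔ i ∈ S ∧ 0 < i ∧ i - 1 ∉ S :=
  Finset.mem_filter

theorem pathDes_eq {M : ℕ} (w : Fin M → Bool) : pathDes w = valleys (north w) := by
  ext i
  rw [pathDes, Finset.mem_filter, Finset.mem_Ioo, mem_valleys]
  constructor
  · rintro ⟨⟨h0, h1⟩, h, h2, h3⟩
    refine ⟨(mem_north w h).2 h3, h0, ?_⟩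
    rw [mem_north w (by omega), h2]
    simp
  · rintro ⟨h1, h0, h2⟩
    have h := lt_of_mem_north h1
    rw [mem_north w (by omega), Bool.not_eq_true] at h2
    exact ⟨⟨h0, h⟩, h, h2, (mem_north w h).1 h1⟩

namespace IsDyckSet

variable {m : ℕ} {S : Finset ℕ}

theorem cnt_last (h : IsDyckSet m S) : cnt S (2 * (m + 1)) = m + 1 := by
  rw [cnt_eq_card h.lt, h.card]

theorem zero_mem (h : IsDyckSet m S) : 0 ∈ S := by
  by_contra hc
  have h1 := h.ballot 1 (by omega)
  have h2 := cnt_succ_of_notMem hc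
  rw [cnt_zero, zero_add] at h2
  omega

theorem last_notMem (h : IsDyckSet m S) : 2 * m + 1 ∉ S := by
  intro hc
  have h1 := h.ballot (2 * m + 1) (by omega)
  have h2 := cnt_succ_of_mem hc
  have h3 := h.cnt_last
  change cnt S (2 * m + 1 + 1) = m + 1 at h3
  omega

theorem valley_bounds (h : IsDyckSet m S) {i : ℕ} (hi : i ∈ valleys S) :
    1 ≤ cnt S i ∧ cnt S i ≤ m ∧ cnt S i + 1 ≤ i ∧ i ≤ 2 * cnt S i := by
  obtain ⟨h1, h0, h2⟩ := mem_valleys.1 hi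
  have h3 := h.ballot i (h.lt i h1).le
  have h4 := cnt_lt_of_mem h1 (h.lt i h1)
  have h5 := cnt_lt_add_of_notMem h2 h0
  rw [h.cnt_last] at h4
  rw [cnt_zero] at h5
  omega

end IsDyckSet

/-- The `x`- and `y`-coordinates of the valleys of a Dyck path, decreased by one. -/
noncomputable def valleyPair (S : Finset ℕ) : Finset ℕ × Finset ℕ :=
  ((valleys S).image fun i => i - cnt S i - 1, (valleys S).image fun i => cnt S i - 1)

namespace IsDyckSet

variable {m : ℕ} {S T : Finset ℕ}

theorem injOn_fst (h : IsDyckSet m S) : Set.InjOn (fun i => i - cnt S i - 1) (valleys S) := by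
  intro i hi j hj e
  have h1 := h.valley_bounds hi
  have h2 := h.valley_bounds hj
  simp only at e
  rcases lt_trichotomy i j with hlt | rfl | hlt
  · have := cnt_lt_add_of_notMem (mem_valleys.1 hj).2.2 hlt
    omega
  · rfl
  · have := cnt_lt_add_of_notMem (mem_valleys.1 hi).2.2 hlt
    omega

theorem injOn_snd (h : IsDyckSet m S) : Set.InjOn (fun i => cnt S i - 1) (valleys S) := by
  intro i hi j hj e
  have h1 := h.valley_bounds hi
  have h2 := h.valley_bounds hj
  simp only at e
  rcases lt_trichotomy i j with hlt | rfl | hlt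
  · have := cnt_lt_of_mem (mem_valleys.1 hi).1 hlt
    omega
  · rfl
  · have := cnt_lt_of_mem (mem_valleys.1 hj).1 hlt
    omega

theorem isBallot_valleyPair (h : IsDyckSet m S) : IsBallot_s7 m (valleyPair S) where
  card_eq := by
    rw [valleyPair, Finset.card_image_of_injOn h.injOn_fst, Finset.card_image_of_injOn h.injOn_snd]
  lt_left x hx := by
    obtain ⟨i, hi, rfl⟩ := Finset.mem_image.1 hx
    have := h.valley_bounds hi
    omega
  lt_right x hx := by
    obtain ⟨i, hi, rfl⟩ := Finset.mem_image.1 hx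
    have := h.valley_bounds hi
    omega
  ballot k := by
    rw [valleyPair, cnt_image h.injOn_fst, cnt_image h.injOn_snd]
    refine Finset.card_le_card fun i hi => ?_
    rw [Finset.mem_filter] at hi ⊢
    have := h.valley_bounds hi.1
    exact ⟨hi.1, by omega⟩

theorem mem_of_valleyPair_eq (h : IsDyckSet m S) (h' : IsDyckSet m T)
    (e : valleyPair S = valleyPair T) {k : ℕ} (hlt : ∀ j < k, j ∈ S ↔ j ∈ T) (hk : k ∈ S) :
    k ∈ T := by
  by_contra hkT
  have hk0 : 0 < k := Nat.pos_of_ne_zero fun h0 => hkT (h0 ▸ h'.zero_mem)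
  have hc := cnt_congr hlt
  by_cases hv : k - 1 ∈ S
  · obtain ⟨i, ⟨hki, hi⟩, hmin⟩ : ∃ i, (k ≤ i ∧ i ∈ T) ∧ ∀ j < i, ¬ (k ≤ j ∧ j ∈ T) := by
      have hex : ∃ i, k ≤ i ∧ i ∈ T := by
        by_contra hno
        push Not at hno
        have h1 := cnt_eq_of_forall_notMem (h.lt k hk).le fun x hx _ => hno x hx
        have h2 := cnt_lt_of_mem hk (h.lt k hk)
        rw [h.cnt_last] at h2
        rw [h'.cnt_last] at h1
        omega
      exact ⟨Nat.find hex, Nat.find_spec hex, fun j hj => Nat.find_min hex hj⟩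
    have hik : i ≠ k := fun h0 => hkT (h0 ▸ hi)
    have hiv : i ∈ valleys T :=
      mem_valleys.2 ⟨hi, by omega, fun hm => hmin (i - 1) (by omega) ⟨by omega, hm⟩⟩
    have hci := cnt_eq_of_forall_notMem hki fun x hx hx' hm => hmin x hx' ⟨hx, hm⟩
    have hmem : cnt T i - 1 ∈ (valleyPair S).2 := e ▸ Finset.mem_image_of_mem _ hiv
    obtain ⟨j, hj, ej⟩ := Finset.mem_image.1 hmem
    have hb := h'.valley_bounds hiv
    have hb' := h.valley_bounds hj
    obtain ⟨hj1, hj2, hj3⟩ := mem_valleys.1 hj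
    rcases lt_trichotomy j k with hjk | rfl | hjk
    · have := cnt_lt_of_mem hj1 hjk
      omega
    · exact hj3 hv
    · have := cnt_lt_of_mem hk hjk
      omega
  · have hkv : k ∈ valleys S := mem_valleys.2 ⟨hk, hk0, hv⟩
    have hmem : k - cnt S k - 1 ∈ (valleyPair T).1 := e ▸ Finset.mem_image_of_mem _ hkv
    obtain ⟨j, hj, ej⟩ := Finset.mem_image.1 hmem
    have hb := h.valley_bounds hkv
    have hb' := h'.valley_bounds hj
    obtain ⟨hj1, hj2, hj3⟩ := mem_valleys.1 hj
    rcases lt_trichotomy j k with hjk | rfl | hjk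
    · rw [hlt (k - 1) (by omega)] at hv
      have := cnt_lt_add_of_notMem hv hjk
      omega
    · exact hkT hj1
    · have := cnt_lt_add_of_notMem hj3 hjk
      omega

end IsDyckSet

theorem injOn_valleyPair (m : ℕ) : Set.InjOn valleyPair {S | IsDyckSet m S} := by
  intro S h T h' e
  ext k
  induction k using Nat.strong_induction_on with
  | h k ih =>
    exact ⟨h.mem_of_valleyPair_eq h' e ih,
      h'.mem_of_valleyPair_eq h e.symm fun j hj => (ih j hj).symm⟩

/-- The north steps at odd positions and the east steps at even positions of a path. -/
noncomputable def parityPair (m : ℕ) (S : Finset ℕ) : Finset ℕ × Finset ℕ :=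
  ((Finset.range m).filter fun j => 2 * j + 1 ∈ S, (Finset.range m).filter fun j => 2 * j + 2 ∉ S)

theorem cnt_parityPair {m : ℕ} {S : Finset ℕ} (h0 : 0 ∈ S) {j : ℕ} (hj : j ≤ m) :
    cnt S (2 * j + 1) + cnt (parityPair m S).2 j = 1 + cnt (parityPair m S).1 j + j := by
  induction j with
  | zero => rw [mul_zero, cnt_succ_of_mem h0]; simp [cnt_zero]
  | succ j ih =>
    have hj' : j < m := hj
    have ih := ih hj'.le
    rw [mul_add_one, cnt_succ, cnt_succ, cnt_succ (parityPair m S).1, cnt_succ (parityPair m S).2]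
    have h1 : j ∈ (parityPair m S).1 ↔ 2 * j + 1 ∈ S := by simp [parityPair, hj']
    have h2 : j ∈ (parityPair m S).2 ↔ 2 * j + 2 ∉ S := by simp [parityPair, hj']
    rw [if_congr h1 rfl rfl, if_congr h2 rfl rfl, ite_not]
    split_ifs <;> omega

theorem IsDyckSet.isBallot_parityPair {m : ℕ} {S : Finset ℕ} (h : IsDyckSet m S) :
    IsBallot_s7 m (parityPair m S) := by
  have hl : ∀ x ∈ (parityPair m S).1, x < m := fun x hx => by simp [parityPair] at hx; exact hx.1
  have hr : ∀ x ∈ (parityPair m S).2, x < m := fun x hx => by simp [parityPair] at hx; exact hx.1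
  have hcard : (parityPair m S).1.card = (parityPair m S).2.card := by
    have h1 := cnt_parityPair h.zero_mem (le_refl m)
    have h2 := cnt_succ_of_notMem h.last_notMem
    have h3 := h.cnt_last
    change cnt S (2 * m + 1 + 1) = m + 1 at h3
    rw [cnt_eq_card hl, cnt_eq_card hr] at h1
    omega
  refine ⟨hcard, hl, hr, fun k => ?_⟩
  rcases le_total k m with hk | hk
  · have h1 := cnt_parityPair h.zero_mem hk
    have h2 := h.ballot (2 * k + 1) (by omega)
    omega
  · rw [cnt_eq_card fun x hx => (hl x hx).trans_le hk,
      cnt_eq_card fun x hx => (hr x hx).trans_le hk, hcard]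

theorem isDyckSet_of_isBallot_parityPair {m : ℕ} {S : Finset ℕ} (hlt : ∀ x ∈ S, x < 2 * m + 1)
    (h0 : 0 ∈ S) (h : IsBallot_s7 m (parityPair m S)) : IsDyckSet m S := by
  have hodd : ∀ j ≤ m, j + 1 ≤ cnt S (2 * j + 1) := fun j hj => by
    have h1 := cnt_parityPair h0 hj
    have h2 := h.ballot j
    omega
  refine ⟨fun x hx => (hlt x hx).trans_le (by omega), ?_, fun k hk => ?_⟩
  · have h1 := cnt_parityPair h0 (le_refl m)
    rw [cnt_eq_card h.lt_left, cnt_eq_card h.lt_right, h.card_eq, cnt_eq_card hlt] at h1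
    omega
  · rcases Nat.even_or_odd' k with ⟨j, rfl | rfl⟩
    · rcases j with _ | j
      · simp
      · have h1 := hodd j (by omega)
        have h2 := cnt_mono S (show 2 * j + 1 ≤ 2 * (j + 1) by omega)
        omega
    · have h1 := hodd j (by omega)
      omega

theorem bijOn_parityPair (m : ℕ) :
    Set.BijOn (parityPair m) {S | IsDyckSet m S} {p | IsBallot_s7 m p} := by
  refine ⟨fun S h => h.isBallot_parityPair, fun S h T h' e => ?_, fun p hp => ?_⟩
  · ext x
    have hl := congrArg Prod.fst e
    have hr := congrArg Prod.snd e
    simp only [parityPair, Finset.ext_iff, Finset.mem_filter, Finset.mem_range,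
      and_congr_right_iff, not_iff_not] at hl hr
    rcases Nat.even_or_odd' x with ⟨j, rfl | rfl⟩
    · rcases j with _ | j
      · exact iff_of_true h.zero_mem h'.zero_mem
      · by_cases hj : j < m
        · exact hr j hj
        · exact iff_of_false (fun hx => by have := h.lt _ hx; omega)
            fun hx => by have := h'.lt _ hx; omega
    · rcases lt_trichotomy j m with hj | rfl | hj
      · exact hl j hj
      · exact iff_of_false h.last_notMem h'.last_notMem
      · exact iff_of_false (fun hx => by have := h.lt _ hx; omega)
          fun hx => by have := h'.lt _ hx; omega
  · set S := (Finset.range (2 * m + 1)).filter fun i =>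
      i = 0 ∨ (i % 2 = 1 ∧ i / 2 ∈ p.1) ∨ (i % 2 = 0 ∧ i / 2 - 1 ∉ p.2) with hS
    have e : parityPair m S = p := by
      refine Prod.ext ?_ ?_
      · ext j
        have h1 : (2 * j + 1) / 2 = j := by omega
        have h2 : (2 * j + 1) % 2 = 1 := by omega
        simp only [parityPair, hS, Finset.mem_filter, Finset.mem_range, h1, h2]
        have := hp.lt_left j
        constructor
        · rintro ⟨-, -, h3⟩
          simpa using h3
        · intro h3
          exact ⟨this h3, by have := this h3; omega, by simp [h3]⟩
      · ext j
        have h1 : (2 * j + 2) / 2 - 1 = j := by omega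
        have h2 : (2 * j + 2) % 2 = 0 := by omega
        simp only [parityPair, hS, Finset.mem_filter, Finset.mem_range, h1, h2]
        have := hp.lt_right j
        constructor
        · rintro ⟨h3, h4⟩
          by_contra hc
          exact h4 ⟨by omega, by simp [hc]⟩
        · intro h3
          exact ⟨this h3, by simp [h3]⟩
    refine ⟨S, isDyckSet_of_isBallot_parityPair (fun x hx => ?_) (by simp [hS]) (e ▸ hp), e⟩
    rw [hS, Finset.mem_filter, Finset.mem_range] at hx
    exact hx.1

theorem sum_range_two_mul_add_two (f : ℕ → ℕ) (m : ℕ) :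
    ∑ i ∈ Finset.range (2 * (m + 1)), f i =
      f 0 + f 1 + ∑ x ∈ Finset.range m, (f (2 * x + 2) + f (2 * x + 3)) := by
  induction m with
  | zero => simp [Finset.sum_range_succ]
  | succ m ih =>
    have e1 : f (2 * (m + 1)) = f (2 * m + 2) := rfl
    have e2 : f (2 * (m + 1) + 1) = f (2 * m + 3) := rfl
    rw [mul_add_one 2 (m + 1), Finset.sum_range_succ, Finset.sum_range_succ, ih,
      Finset.sum_range_succ, e1, e2]
    ring

theorem IsDyckSet.sum_valleys {m : ℕ} {S : Finset ℕ} (h : IsDyckSet m S) :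
    ∑ i ∈ valleys S, i = valleyWeight m (parityPair m S) := by
  have h1 : ∑ i ∈ valleys S, i =
      ∑ i ∈ Finset.range (2 * (m + 1)), i * if i ∈ valleys S then 1 else 0 := by
    simp only [mul_ite, mul_one, mul_zero]
    rw [← Finset.sum_filter]
    refine Finset.sum_congr ?_ fun _ _ => rfl
    ext i
    rw [Finset.mem_filter, Finset.mem_range, iff_and_self]
    exact fun hi => h.lt i (mem_valleys.1 hi).1
  have h2 : 1 ∉ valleys S := fun hc => (mem_valleys.1 hc).2.2 h.zero_mem
  rw [h1, sum_range_two_mul_add_two, if_neg h2, valleyWeight, zero_mul, mul_zero, zero_add,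
    zero_add]
  refine Finset.sum_congr rfl fun x hx => ?_
  rw [Finset.mem_range] at hx
  have e1 : 2 * x + 2 ∈ valleys S ↔ x ∉ (parityPair m S).1 ∧ x ∉ (parityPair m S).2 := by
    simp [parityPair, hx, mem_valleys, and_comm]
  have e2 : 2 * x + 3 ∈ valleys S ↔ x ∈ (parityPair m S).2 ∧ x + 1 ∈ (parityPair m S).1 := by
    have h3 : 2 * (x + 1) + 1 = 2 * x + 3 := by ring
    have h4 : 2 * x + 3 ∈ S → x + 1 < m := fun h5 => by
      by_contra hc
      have : x + 1 = m := by omega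
      subst this
      exact h.last_notMem (h3 ▸ h5)
    simp only [parityPair, hx, mem_valleys, Finset.mem_filter, Finset.mem_range, h3]
    simp only [Nat.add_succ_sub_one, true_and]
    have h5 : 0 < 2 * x + 3 := by omega
    tauto
  rw [if_congr e1 rfl rfl, if_congr e2 rfl rfl]

theorem bijOn_valleyPair (m : ℕ) :
    Set.BijOn valleyPair {S | IsDyckSet m S} {p | IsBallot_s7 m p} := by
  have hmaps : Set.MapsTo valleyPair {S | IsDyckSet m S} {p | IsBallot_s7 m p} :=
    fun S h => h.isBallot_valleyPair
  have hinj := injOn_valleyPair m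
  have hJ := bijOn_parityPair m
  have hfin : {p | IsBallot_s7 m p}.Finite := by
    rw [← hJ.image_eq, ← (bijOn_north m).image_eq]
    exact ((Set.toFinite _).image _).image _
  refine ⟨hmaps, hinj, ?_⟩
  rw [Set.SurjOn, Set.eq_of_subset_of_ncard_le hmaps.image_subset ?_ hfin]
  rw [hinj.ncard_image, ← hJ.image_eq, hJ.injOn.ncard_image]

theorem IsDyckSet.sum_valleyPair {m : ℕ} {S : Finset ℕ} (h : IsDyckSet m S) :
    ∑ a ∈ (valleyPair S).1, (a + 1) + ∑ b ∈ (valleyPair S).2, (b + 1) = ∑ i ∈ valleys S, i := by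
  rw [valleyPair, Finset.sum_image h.injOn_fst, Finset.sum_image h.injOn_snd,
    ← Finset.sum_add_distrib]
  refine Finset.sum_congr rfl fun i hi => ?_
  have := h.valley_bounds hi
  omega

theorem IsDyckSet.sum_sub_valleyPair {m : ℕ} {S : Finset ℕ} (h : IsDyckSet m S) :
    ∑ a ∈ (valleyPair S).1, (m - a) + ∑ b ∈ (valleyPair S).2, (m - b) =
      ∑ i ∈ valleys S, (2 * (m + 1) - i) := by
  rw [valleyPair, Finset.sum_image h.injOn_fst, Finset.sum_image h.injOn_snd,
    ← Finset.sum_add_distrib]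
  refine Finset.sum_congr rfl fun i hi => ?_
  have := h.valley_bounds hi
  omega

/-- The complement in `{0,…,m-1}` of the mirror image of a set. -/
noncomputable def mirrorCompl (m : ℕ) (S : Finset ℕ) : Finset ℕ :=
  (Finset.range m).filter fun j => m - 1 - j ∉ S

theorem mirrorCompl_mirrorCompl {m : ℕ} {S : Finset ℕ} (h : ∀ x ∈ S, x < m) :
    mirrorCompl m (mirrorCompl m S) = S := by
  ext x
  simp only [mirrorCompl, Finset.mem_filter, Finset.mem_range]
  have hx := h x
  by_cases hm : x < m
  · have e : m - 1 - (m - 1 - x) = x := by omega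
    have e' : m - 1 - x < m := by omega
    simp [hm, e, e']
  · tauto

theorem cnt_mirrorCompl {m : ℕ} {S : Finset ℕ} (h : ∀ x ∈ S, x < m) {k : ℕ} (hk : k ≤ m) :
    cnt (mirrorCompl m S) k + S.card = k + cnt S (m - k) := by
  induction k with
  | zero => rw [cnt_zero, Nat.sub_zero, cnt_eq_card h]
  | succ k ih =>
    have ih := ih (by omega)
    obtain ⟨d, rfl⟩ : ∃ d, m = k + 1 + d := ⟨m - (k + 1), by omega⟩
    have e1 : k + 1 + d - k = d + 1 := by omega
    have e2 : k + 1 + d - (k + 1) = d := by omega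
    have e3 : k ∈ mirrorCompl (k + 1 + d) S ↔ d ∉ S := by
      simp [mirrorCompl, show k < k + 1 + d by omega]
    rw [e1, cnt_succ] at ih
    rw [e2, cnt_succ, if_congr e3 rfl rfl, ite_not]
    split_ifs at ih ⊢ <;> omega

theorem IsBallot_s7.mirrorCompl {m : ℕ} {p : Finset ℕ × Finset ℕ} (h : IsBallot_s7 m p) :
    IsBallot_s7 m (Prod.map (mirrorCompl m) (mirrorCompl m) p) := by
  have hlt : ∀ S : Finset ℕ, ∀ x ∈ Stmt.mirrorCompl m S, x < m := fun S x hx =>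
    Finset.mem_range.1 (Finset.mem_filter.1 hx).1
  have hcard : (Stmt.mirrorCompl m p.1).card = (Stmt.mirrorCompl m p.2).card := by
    have h1 := cnt_mirrorCompl h.lt_left (le_refl m)
    have h2 := cnt_mirrorCompl h.lt_right (le_refl m)
    rw [cnt_eq_card (hlt _), Nat.sub_self, cnt_zero] at h1 h2
    have := h.card_eq
    omega
  refine ⟨hcard, hlt _, hlt _, fun k => ?_⟩
  simp only [Prod.map_fst, Prod.map_snd]
  rcases le_total k m with hk | hk
  · have h1 := cnt_mirrorCompl h.lt_left hk
    have h2 := cnt_mirrorCompl h.lt_right hk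
    have h3 := h.card_eq
    have h4 := h.ballot (m - k)
    omega
  · rw [cnt_eq_card fun x hx => (hlt _ x hx).trans_le hk,
      cnt_eq_card fun x hx => (hlt _ x hx).trans_le hk, hcard]

theorem bijOn_mirrorCompl (m : ℕ) :
    Set.BijOn (Prod.map (mirrorCompl m) (mirrorCompl m)) {p | IsBallot_s7 m p} {p | IsBallot_s7 m p} := by
  have hinv : Set.LeftInvOn (Prod.map (mirrorCompl m) (mirrorCompl m))
      (Prod.map (mirrorCompl m) (mirrorCompl m)) {p | IsBallot_s7 m p} := fun p hp =>
    Prod.ext (mirrorCompl_mirrorCompl hp.lt_left) (mirrorCompl_mirrorCompl hp.lt_right)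
  exact Set.InvOn.bijOn ⟨hinv, hinv⟩ (fun p hp => hp.mirrorCompl) fun p hp => hp.mirrorCompl

theorem two_mul_sum_mirrorCompl {m : ℕ} {S : Finset ℕ} (h : ∀ x ∈ S, x < m) :
    2 * (∑ a ∈ mirrorCompl m S, (a + 1) + ∑ a ∈ S, (m - a)) = m * (m + 1) := by
  have h1 : ∑ a ∈ mirrorCompl m S, (a + 1) =
      ∑ a ∈ (Finset.range m).filter (fun a => ¬ a ∈ S), (m - a) := by
    rw [mirrorCompl, Finset.sum_filter, Finset.sum_filter, ← Finset.sum_range_reflect]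
    refine Finset.sum_congr rfl fun a ha => ?_
    rw [Finset.mem_range] at ha
    have e1 : m - 1 - (m - 1 - a) = a := by omega
    have e2 : m - 1 - a + 1 = m - a := by omega
    rw [e1, e2]
  have h2 : S = (Finset.range m).filter fun a => a ∈ S := by
    ext x
    rw [Finset.mem_filter, Finset.mem_range, iff_and_self]
    exact h x
  have h3 : ∑ a ∈ Finset.range m, (m - a) = ∑ a ∈ Finset.range m, (a + 1) := by
    rw [← Finset.sum_range_reflect]
    refine Finset.sum_congr rfl fun a ha => ?_
    rw [Finset.mem_range] at ha
    omega
  have h4 := Finset.sum_range_id_mul_two (m + 1)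
  rw [Finset.sum_range_succ', add_zero, Nat.add_sub_cancel] at h4
  have h5 := Finset.sum_filter_add_sum_filter_not (Finset.range m) (fun a => a ∈ S) fun a => m - a
  rw [← h2, h3, ← h1] at h5
  rw [mul_comm m, ← h4, ← h5]
  ring

theorem IsBallot_s7.sum_mirrorCompl {m : ℕ} {p : Finset ℕ × Finset ℕ} (h : IsBallot_s7 m p) :
    (∑ a ∈ Stmt.mirrorCompl m p.1, (a + 1) + ∑ b ∈ Stmt.mirrorCompl m p.2, (b + 1)) +
      (∑ a ∈ p.1, (m - a) + ∑ b ∈ p.2, (m - b)) = m * (m + 1) := by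
  have h1 := two_mul_sum_mirrorCompl h.lt_left
  have h2 := two_mul_sum_mirrorCompl h.lt_right
  omega

theorem ncard_sep_eq_of_bijOn {α β : Type*} {f : α → β} {s : Set α} {t : Set β} {P : α → Prop}
    {Q : β → Prop} (hf : Set.BijOn f s t) (h : ∀ x ∈ s, P x ↔ Q (f x)) :
    {x | x ∈ s ∧ P x}.ncard = {y | y ∈ t ∧ Q y}.ncard := by
  have hb : Set.BijOn f {x | x ∈ s ∧ P x} {y | y ∈ t ∧ Q y} := by
    refine ⟨fun x hx => ⟨hf.mapsTo hx.1, (h x hx.1).1 hx.2⟩,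
      hf.injOn.mono fun x hx => hx.1, fun y hy => ?_⟩
    obtain ⟨x, hx, rfl⟩ := hf.surjOn hy.1
    exact ⟨x, ⟨hx, (h x hx).2 hy.2⟩, rfl⟩
  rw [← hb.image_eq, hb.injOn.ncard_image]

/-- For every `n ≥ 1` and every `k`, Dyck paths of length `n` with major index
`k` are equinumerous with non-crossing permutations `σ` of `{1,…,n}` with
`maj(σ) + imaj(σ) = k`. -/
theorem maj_eq_majimaj_NC (n : ℕ) (hn : 1 ≤ n) (k : ℕ) :
    {w : Fin (2 * n) → Bool | IsDyckA n w ∧ majA n w = k}.ncard =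
      {σ : Equiv.Perm (Fin n) | IsNC σ ∧ majP σ + imajP σ = k}.ncard := by
  obtain ⟨m, rfl⟩ : ∃ m, n = m + 1 := ⟨n - 1, by omega⟩
  have hN := ncard_sep_eq_of_bijOn (P := fun w => majA (m + 1) w = k)
    (Q := fun S => ∑ i ∈ valleys S, (2 * (m + 1) - i) = k) (bijOn_north m)
    fun w _ => by rw [majA, pathDes_eq]
  have hV := ncard_sep_eq_of_bijOn (P := fun S => ∑ i ∈ valleys S, (2 * (m + 1) - i) = k)
    (Q := fun p => ∑ a ∈ p.1, (m - a) + ∑ b ∈ p.2, (m - b) = k) (bijOn_valleyPair m)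
    fun S hS => by rw [hS.sum_sub_valleyPair]
  have hR := ncard_sep_eq_of_bijOn (P := fun p => ∑ a ∈ p.1, (m - a) + ∑ b ∈ p.2, (m - b) = k)
    (Q := fun p => ∑ a ∈ p.1, (a + 1) + ∑ b ∈ p.2, (b + 1) + k = m * (m + 1))
    (bijOn_mirrorCompl m) fun p hp => by
      have := hp.sum_mirrorCompl
      simp only [Prod.map_fst, Prod.map_snd]
      omega
  have hV' := ncard_sep_eq_of_bijOn (P := fun S => ∑ i ∈ valleys S, i + k = m * (m + 1))
    (Q := fun p => ∑ a ∈ p.1, (a + 1) + ∑ b ∈ p.2, (b + 1) + k = m * (m + 1))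
    (bijOn_valleyPair m) fun S hS => by rw [hS.sum_valleyPair]
  have hJ := ncard_sep_eq_of_bijOn (P := fun S => ∑ i ∈ valleys S, i + k = m * (m + 1))
    (Q := fun p => valleyWeight m p + k = m * (m + 1)) (bijOn_parityPair m)
    fun S hS => by rw [hS.sum_valleys]
  have hA := ncard_sep_eq_of_bijOn (P := fun σ => majP σ + imajP σ = k)
    (Q := fun p => valleyWeight m p + k = m * (m + 1)) (bijOn_arcPair m)
    fun σ hσ => by
      rw [← majP_add_imajP hσ, add_comm _ (valleyWeight m _), add_right_inj, eq_comm]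
  exact hN.trans (hV.trans (hR.trans (hV'.symm.trans (hJ.trans hA.symm))))

end Stmt
end
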